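/- If a class $\mathcal{H}$ contains $d$ thresholds, then any $(1/16,1/16)$-accurate, $(0.1, O(1/(m^2\log m)))$-differentially private learning algorithm for $\mathcal{H}$ with sample complexity $m$ satisfies $m \geq \Omega(\log^* d)$; combined with the fact that Littlestone dimension $d$ implies $\lfloor \log d \rfloor$ thresholds, any such private learner for a class of Littlestone dimension $d$ requires $m \geq \Omega(\log^* d)$ samples. -/

import Mathlib

noncomputable def massProb {α : Type*} (p : α → ℝ) (E : Set α) : ℝ :=
  ∑' a, Set.indicator E p a

def IsProbMass {α : Type*} (p : α → ℝ) : Prop :=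
  (∀ a, 0 ≤ p a) ∧ HasSum p 1

def Indist {α : Type*} (p q : α → ℝ) (ε δ : ℝ) : Prop :=
  ∀ E : Set α,
    massProb p E ≤ Real.exp ε * massProb q E + δ ∧
    massProb q E ≤ Real.exp ε * massProb p E + δ

/-- `H` shatters some complete mistake tree of depth `d`. -/
def LdimGe {X : Type*} (H : Set (X → Bool)) (d : ℕ) : Prop :=
  ∃ T : List Bool → X, ∀ l : List Bool, l.length = d →
    ∃ h ∈ H, ∀ k < d, h (T (l.take k)) = l.getD k false

/-- `H` contains `d` thresholds. -/
def ContainsThresholds {X : Type*} (H : Set (X → Bool)) (d : ℕ) : Prop :=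
  ∃ (x : Fin d → X) (h : Fin d → X → Bool),
    (∀ i, h i ∈ H) ∧
    ∀ i j : Fin d, h i (x j) = true ↔ (i : ℕ) ≤ (j : ℕ)

/-- A randomized learner (represented by the probability mass functions of its
outputs) is `(ε,δ)`-differentially private: samples differing in one example
yield `(ε,δ)`-indistinguishable output distributions. -/
def PrivateAlg {X : Type*} {m : ℕ}
    (A : (Fin m → X × Bool) → (X → Bool) → ℝ) (ε δ : ℝ) : Prop :=
  ∀ S S' : Fin m → X × Bool,
    (∃ i₀, ∀ i, i ≠ i₀ → S i = S' i) → Indist (A S) (A S') ε δ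

/-- `(α,β)`-accurate PAC learner for `H` (realizable case): for every realizable
distribution `D` on `X × Bool`, with probability at least `1-β` over an i.i.d.
sample `S ∼ Dᵐ` and `h ∼ A(S)`, the loss `L_D(h)` is at most `α`. -/
def AccurateLearner {X : Type*} {m : ℕ} (H : Set (X → Bool))
    (A : (Fin m → X × Bool) → (X → Bool) → ℝ) (α β : ℝ) : Prop :=
  ∀ D : X × Bool → ℝ, IsProbMass D →
    (∃ h ∈ H, massProb D {p | h p.1 ≠ p.2} = 0) →
    massProb
      (fun Sh : (Fin m → X × Bool) × (X → Bool) =>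
        (∏ i, D (Sh.1 i)) * A Sh.1 Sh.2)
      {Sh | α < massProb D {p | Sh.2 p.1 ≠ p.2}} ≤ β

/-- `log*`. -/
noncomputable def logStar (x : ℝ) : ℕ :=
  sInf {k | (fun y => Real.logb 2 y)^[k] x ≤ 1}

/-- Every colour of `insert x T`, for `T ⊆ A` and `x ∈ B` above all of `T`, depends only on `T`. -/
def EndHomogeneous {C : Type*} (c : Finset ℕ → C) (A B : Finset ℕ) : Prop :=
  ∀ T ⊆ A, ∀ x ∈ B, ∀ y ∈ B, (∀ t ∈ T, t < x) → (∀ t ∈ T, t < y) →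
    c (insert x T) = c (insert y T)

theorem exists_endHomogeneous_extension {C : Type*} [Fintype C] (c : Finset ℕ → C) (J : ℕ) :
    ∀ (L : ℕ) (A R : Finset ℕ), A.card + L ≤ J → (∀ a ∈ A, ∀ x ∈ R, a < x) →
      EndHomogeneous c A (A ∪ R) → (2 * Fintype.card C ^ 2 ^ J) ^ L ≤ R.card →
      ∃ A' ⊆ A ∪ R, A'.card = A.card + L ∧ EndHomogeneous c A' A' := by
  classical
  intro L
  induction L with
  | zero =>
    intro A R _ _ hE _
    exact ⟨A, Finset.subset_union_left, rfl, fun T hT x hx y hy =>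
      hE T hT x (Finset.mem_union_left _ hx) y (Finset.mem_union_left _ hy)⟩
  | succ L ih =>
    intro A R hJ hAR hE hR
    have hC : 0 < Fintype.card C := Fintype.card_pos_iff.mpr ⟨c ∅⟩
    have hK : 0 < 2 * Fintype.card C ^ 2 ^ J := by positivity
    have hRne : R.Nonempty := by
      rw [← Finset.card_pos]
      exact lt_of_lt_of_le (by positivity) hR
    obtain ⟨a, haR, ha⟩ : ∃ a ∈ R, ∀ x ∈ R, a ≤ x := ⟨R.min' hRne, R.min'_mem hRne,
      fun x hx => R.min'_le x hx⟩
    have haA : a ∉ A := fun h => lt_irrefl _ (hAR a h a haR)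
    let F : ℕ → (A.powerset → C) := fun x T => c (insert x (insert a T.1))
    have hcard : Fintype.card (A.powerset → C) ≤ Fintype.card C ^ 2 ^ J := by
      rw [Fintype.card_fun, Fintype.card_coe, Finset.card_powerset]
      exact Nat.pow_le_pow_right hC (Nat.pow_le_pow_right (by norm_num) (by omega))
    obtain ⟨y, -, hy⟩ := Finset.exists_le_card_fiber_of_mul_le_card_of_maps_to
      (s := R.erase a) (t := (Finset.univ : Finset (A.powerset → C))) (f := F)
      (n := (2 * Fintype.card C ^ 2 ^ J) ^ L) (fun _ _ => Finset.mem_univ _)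
      ⟨F 0, Finset.mem_univ _⟩ (by
        rw [Finset.card_univ, Finset.card_erase_of_mem haR]
        have h1 := Nat.mul_le_mul_right ((2 * Fintype.card C ^ 2 ^ J) ^ L) hcard
        have h2 : (2 * Fintype.card C ^ 2 ^ J) ^ (L + 1)
            = 2 * (Fintype.card C ^ 2 ^ J * (2 * Fintype.card C ^ 2 ^ J) ^ L) := by ring
        have h3 : 0 < Fintype.card C ^ 2 ^ J * (2 * Fintype.card C ^ 2 ^ J) ^ L := by positivity
        omega)
    set R' := (R.erase a).filter (fun x => F x = y) with hR'
    have hsub : R' ⊆ R := (Finset.filter_subset _ _).trans (Finset.erase_subset _ _)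
    have hgt : ∀ x ∈ R', a < x := fun x hx => by
      have h := Finset.mem_erase.mp (Finset.mem_filter.mp hx).1
      exact lt_of_le_of_ne (ha x h.2) (Ne.symm h.1)
    have hun : insert a A ∪ R' ⊆ A ∪ R := by
      intro x hx
      simp only [Finset.mem_union, Finset.mem_insert] at hx ⊢
      rcases hx with (rfl | h) | h
      · exact Or.inr haR
      · exact Or.inl h
      · exact Or.inr (hsub h)
    obtain ⟨A', hA', hcA', hEA'⟩ := ih (insert a A) R'
      (by rw [Finset.card_insert_of_notMem haA]; omega)
      (by
        intro b hb x hx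
        rcases Finset.mem_insert.mp hb with rfl | hb
        · exact hgt x hx
        · exact hAR b hb x (hsub hx))
      (by
        intro T hT x hx z hz hxT hzT
        by_cases haT : a ∈ T
        · have key : ∀ x ∈ insert a A ∪ R', (∀ t ∈ T, t < x) → x ∈ R' := by
            intro x hx hxT
            rcases Finset.mem_union.mp hx with h | h
            · rcases Finset.mem_insert.mp h with rfl | h
              · exact absurd (hxT _ haT) (lt_irrefl _)
              · exact absurd (hxT _ haT) (not_lt.mpr (hAR x h a haR).le)
            · exact h
          have hTA : T.erase a ∈ A.powerset := by
            rw [Finset.mem_powerset]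
            intro t ht
            obtain ⟨h1, h2⟩ := Finset.mem_erase.mp ht
            exact (Finset.mem_insert.mp (hT h2)).resolve_left h1
          have h1 := (Finset.mem_filter.mp (key x hx hxT)).2
          have h2 := (Finset.mem_filter.mp (key z hz hzT)).2
          have h3 := congrFun (h1.trans h2.symm) ⟨T.erase a, hTA⟩
          simpa only [F, Finset.insert_erase haT] using h3
        · have hTA : T ⊆ A := fun t ht =>
            (Finset.mem_insert.mp (hT ht)).resolve_left (fun h => haT (h ▸ ht))
          exact hE T hTA x (hun hx) z (hun hz) hxT hzT)
      hy
    refine ⟨A', hA'.trans hun, ?_, hEA'⟩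
    rw [hcA', Finset.card_insert_of_notMem haA]
    omega

/-- The number of points that suffice to find a set of `M` points homogeneous for a colouring of
the `r`-subsets with `q` colours. -/
def ramseyBound (q M : ℕ) : ℕ → ℕ
  | 0 => M
  | r + 1 => (2 * q ^ 2 ^ (ramseyBound q M r + 1)) ^ (ramseyBound q M r + 2)

/-- The Erdős–Rado form of Ramsey's theorem for uniform hypergraphs. -/
theorem exists_homogeneous {C : Type*} [Fintype C] (M : ℕ) :
    ∀ (r : ℕ) (c : Finset ℕ → C) (V : Finset ℕ), ramseyBound (Fintype.card C) M r ≤ V.card →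
      ∃ U ⊆ V, U.card = M ∧ ∃ κ, ∀ T ⊆ U, T.card = r → c T = κ := by
  classical
  intro r
  induction r with
  | zero =>
    intro c V hV
    obtain ⟨U, hU, hcU⟩ := Finset.exists_subset_card_eq hV
    exact ⟨U, hU, hcU, c ∅, fun T _ hT => by rw [Finset.card_eq_zero.mp hT]⟩
  | succ r ih =>
    intro c V hV
    set N := ramseyBound (Fintype.card C) M r with hN
    have hC : 0 < Fintype.card C := Fintype.card_pos_iff.mpr ⟨c ∅⟩
    obtain ⟨y, -, hy⟩ := Finset.exists_le_card_fiber_of_mul_le_card_of_maps_to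
      (s := V) (t := (Finset.univ : Finset C)) (f := fun x => c {x})
      (n := (2 * Fintype.card C ^ 2 ^ (N + 1)) ^ (N + 1)) (fun _ _ => Finset.mem_univ _)
      ⟨c ∅, Finset.mem_univ _⟩ (by
        refine le_trans ?_ hV
        rw [Finset.card_univ, ramseyBound, ← hN, pow_succ _ (N + 1), mul_comm]
        refine Nat.mul_le_mul_left _ ?_
        calc Fintype.card C = Fintype.card C ^ 1 := (pow_one _).symm
          _ ≤ Fintype.card C ^ 2 ^ (N + 1) := Nat.pow_le_pow_right hC Nat.one_le_two_pow
          _ ≤ _ := Nat.le_mul_of_pos_left _ (by norm_num))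
    obtain ⟨A, hAV, hcA, hA⟩ := exists_endHomogeneous_extension c
      (N + 1) (N + 1) ∅ (V.filter fun x => c {x} = y) (by simp) (by simp)
      (by
        intro T hT x hx z hz _ _
        rw [Finset.subset_empty.mp hT]
        simp only [Finset.empty_union, Finset.mem_filter] at hx hz
        exact hx.2.trans hz.2.symm) hy
    rw [Finset.card_empty, zero_add] at hcA
    have hAne : A.Nonempty := by
      rw [← Finset.card_pos]
      omega
    obtain ⟨z, hzA, hz⟩ : ∃ z ∈ A, ∀ x ∈ A, x ≤ z := ⟨A.max' hAne, A.max'_mem hAne,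
      fun x hx => A.le_max' x hx⟩
    obtain ⟨U, hU, hcU, κ, hκ⟩ := ih (fun T => c (insert z T)) (A.erase z)
      (by rw [Finset.card_erase_of_mem hzA, hcA]; omega)
    have hUA : U ⊆ A := hU.trans (Finset.erase_subset _ _)
    refine ⟨U, hUA.trans (hAV.trans ?_), hcU, κ, ?_⟩
    · rw [Finset.empty_union]
      exact Finset.filter_subset _ _
    · intro T hT hcT
      have hTne : T.Nonempty := by
        rw [← Finset.card_pos]
        omega
      set x := T.max' hTne with hx
      have hxT : x ∈ T := T.max'_mem hTne
      have h1 := hκ (T.erase x) ((Finset.erase_subset _ _).trans hT)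
        (by rw [Finset.card_erase_of_mem hxT]; omega)
      rw [← h1]
      conv_lhs => rw [← Finset.insert_erase hxT]
      refine hA (T.erase x) ((Finset.erase_subset _ _).trans (hT.trans hUA)) x (hUA (hT hxT)) z hzA
        (fun t ht => ?_) (fun t ht => ?_)
      · exact T.lt_max'_of_mem_erase_max' hTne ht
      · have h2 := Finset.mem_erase.mp (hU (hT (Finset.mem_of_mem_erase ht)))
        exact lt_of_le_of_ne (hz t h2.2) h2.1

/-- A finite family of functions of tuples can be made almost invariant under changes of the
tuple that preserve its order type, by restricting to a long subsequence. -/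
theorem exists_orderInvariant_subsequence {K ι : Type*} [Fintype K] [Fintype ι]
    (Γ : K → (ι → ℕ) → ℝ) (h0 : ∀ k t, 0 ≤ Γ k t) (h1 : ∀ k t, Γ k t ≤ 1)
    (Q : ℕ) (hQ : 0 < Q) (M N : ℕ)
    (hN : ramseyBound
      ((Q + 1) ^ (Fintype.card K * Fintype.card ι ^ Fintype.card ι)) M (Fintype.card ι) ≤ N) :
    ∃ g : ℕ → ℕ, (∀ i j, i < j → j < M → g i < g j) ∧ (∀ i < M, g i < N) ∧
      ∀ k, ∀ t t' : ι → ℕ, Function.Injective t → (∀ a b, t a < t b → t' a < t' b) →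
        (∀ a, t a < M) → (∀ a, t' a < M) →
        |Γ k (g ∘ t) - Γ k (g ∘ t')| ≤ 1 / Q := by
  classical
  set r := Fintype.card ι with hr
  let c : Finset ℕ → (K × (ι → Fin r) → Fin (Q + 1)) := fun T kφ =>
    if hT : T.card = r then
      ⟨⌊Q * Γ kφ.1 (T.orderEmbOfFin hT ∘ kφ.2)⌋₊, by
        rw [Nat.lt_succ_iff]
        apply Nat.floor_le_of_le
        exact mul_le_of_le_one_right (by positivity) (h1 _ _)⟩
    else 0
  obtain ⟨U, hU, hcU, κ, hκ⟩ := exists_homogeneous M r c (Finset.range N) (by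
    simp only [Fintype.card_fun, Fintype.card_prod, Fintype.card_fin, Finset.card_range, ← hr]
    exact hN)
  let g : ℕ → ℕ := fun i => if h : i < M then U.orderEmbOfFin hcU ⟨i, h⟩ else 0
  have hg : ∀ i j, i < j → j < M → g i < g j := by
    intro i j hij hj
    simp only [g, hj, hij.trans hj, dif_pos]
    exact (U.orderEmbOfFin hcU).strictMono hij
  have hgU : ∀ i < M, g i ∈ U := by
    intro i hi
    simp only [g, hi, dif_pos]
    exact U.orderEmbOfFin_mem hcU _
  refine ⟨g, hg, fun i hi => Finset.mem_range.mp (hU (hgU i hi)), ?_⟩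
  intro k t t' ht htt' htM htM'
  let eqv : ι ≃ Fin r := Fintype.equivFin ι
  let σ : Equiv.Perm (Fin r) := Tuple.sort (t ∘ eqv.symm)
  have hmono : StrictMono (t ∘ eqv.symm ∘ σ) :=
    (Tuple.monotone_sort (t ∘ eqv.symm)).strictMono_of_injective
      (ht.comp (eqv.symm.injective.comp σ.injective))
  have hmono' : StrictMono (t' ∘ eqv.symm ∘ σ) := fun a b hab => htt' _ _ (hmono hab)
  have key : ∀ s : ι → ℕ, (∀ a, s a < M) → StrictMono (s ∘ eqv.symm ∘ σ) →
      ((κ (k, σ.symm ∘ eqv) : Fin (Q + 1)) : ℕ) = ⌊Q * Γ k (g ∘ s)⌋₊ := by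
    intro s hs hmono
    let e : Fin r → ℕ := g ∘ s ∘ eqv.symm ∘ σ
    have he : StrictMono e := fun a b hab => hg _ _ (hmono hab) (hs _)
    have hT : (Finset.univ.image e).card = r := by
      rw [Finset.card_image_of_injective _ he.injective, Finset.card_univ, Fintype.card_fin]
    have hκT := hκ (Finset.univ.image e) (by
      intro x hx
      obtain ⟨a, -, rfl⟩ := Finset.mem_image.mp hx
      exact hgU _ (hs _)) hT
    have he' : e = (Finset.univ.image e).orderEmbOfFin hT :=
      Finset.orderEmbOfFin_unique hT (fun a => Finset.mem_image_of_mem _ (Finset.mem_univ _)) he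
    rw [← hκT]
    simp only [c, hT, dif_pos]
    rw [← he']
    congr 3
    funext a
    simp [e]
  have h2 := (key t htM hmono).symm.trans (key t' htM' hmono')
  have hQ' : (0 : ℝ) < Q := by exact_mod_cast hQ
  have p1 : 0 ≤ Q * Γ k (g ∘ t) := mul_nonneg hQ'.le (h0 _ _)
  have p2 : 0 ≤ Q * Γ k (g ∘ t') := mul_nonneg hQ'.le (h0 _ _)
  have a1 := Nat.floor_le p1
  have a2 := Nat.lt_floor_add_one (Q * Γ k (g ∘ t))
  have a3 := Nat.floor_le p2
  have a4 := Nat.lt_floor_add_one (Q * Γ k (g ∘ t'))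
  rw [h2] at a1 a2
  rw [le_div_iff₀ hQ']
  calc |Γ k (g ∘ t) - Γ k (g ∘ t')| * Q = |Q * Γ k (g ∘ t) - Q * Γ k (g ∘ t')| := by
        rw [← mul_sub, abs_mul, abs_of_pos hQ', mul_comm]
    _ ≤ 1 := by
        rw [abs_le]
        constructor <;> linarith

/-- `H` shatters a complete tree of depth `d` with nodes in `Y`. -/
def ShattersTree {X : Type*} (Y : Set X) : Set (X → Bool) → ℕ → Prop
  | H, 0 => H.Nonempty
  | H, d + 1 => ∃ x ∈ Y, ∀ b, ShattersTree Y {h ∈ H | h x = b} d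

theorem LdimGe.shattersTree {X : Type*} {d : ℕ} :
    ∀ {H : Set (X → Bool)}, LdimGe H d → ShattersTree Set.univ H d := by
  induction d with
  | zero =>
    rintro H ⟨T, hT⟩
    obtain ⟨h, hh, -⟩ := hT [] rfl
    exact ⟨h, hh⟩
  | succ d ih =>
    rintro H ⟨T, hT⟩
    refine ⟨T [], Set.mem_univ _, fun b => ih ⟨fun l => T (b :: l), fun l hl => ?_⟩⟩
    obtain ⟨h, hh, hhT⟩ := hT (b :: l) (by simp [hl])
    refine ⟨h, ⟨hh, ?_⟩, fun k hk => ?_⟩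
    · simpa using hhT 0 (Nat.succ_pos _)
    · simpa using hhT (k + 1) (Nat.succ_lt_succ hk)

theorem ShattersTree.mono_set {X : Type*} {Y : Set X} {d : ℕ} :
    ∀ {H H' : Set (X → Bool)}, H ⊆ H' → ShattersTree Y H d → ShattersTree Y H' d := by
  induction d with
  | zero => exact fun hH h => h.mono hH
  | succ d ih =>
    rintro H H' hH ⟨x, hx, h⟩
    exact ⟨x, hx, fun b => ih (fun g hg => ⟨hH hg.1, hg.2⟩) (h b)⟩

theorem ShattersTree.of_succ {X : Type*} {Y : Set X} {d : ℕ} {H : Set (X → Bool)}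
    (h : ShattersTree Y H (d + 1)) : ShattersTree Y H d := by
  obtain ⟨x, -, h⟩ := h
  exact (h true).mono_set (fun g hg => hg.1)

theorem ShattersTree.mono_depth {X : Type*} {Y : Set X} {d d' : ℕ} {H : Set (X → Bool)}
    (hd : d ≤ d') (h : ShattersTree Y H d') : ShattersTree Y H d := by
  induction hd with
  | refl => exact h
  | step _ ih => exact ih h.of_succ

theorem ShattersTree.nonempty {X : Type*} {Y : Set X} {d : ℕ} {H : Set (X → Bool)}
    (h : ShattersTree Y H d) : H.Nonempty :=
  h.mono_depth (Nat.zero_le d)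

theorem ShattersTree.split {X : Type*} {Y : Set X} (P : X → Prop) (n : ℕ) :
    ∀ (a b : ℕ), a + b = n → ∀ H : Set (X → Bool), ShattersTree Y H (a + b) →
      ShattersTree {x ∈ Y | P x} H a ∨ ShattersTree {x ∈ Y | ¬ P x} H b := by
  induction n with
  | zero =>
    intro a b hab H h
    obtain rfl : a = 0 := by omega
    exact Or.inl h.nonempty
  | succ n ih =>
    intro a b hab H h
    rcases a with _ | a
    · exact Or.inl h.nonempty
    rcases b with _ | b
    · exact Or.inr h.nonempty
    have h' : ShattersTree Y H ((a + b + 1) + 1) := by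
      rwa [show a + b + 1 + 1 = a + 1 + (b + 1) by omega]
    obtain ⟨x, hx, hb⟩ := h'
    by_cases hP : P x
    · by_cases hc : ∃ c, ShattersTree {x ∈ Y | ¬ P x} {h ∈ H | h x = c} (b + 1)
      · obtain ⟨c, hc⟩ := hc
        exact Or.inr (hc.mono_set fun g hg => hg.1)
      · push Not at hc
        exact Or.inl ⟨x, ⟨hx, hP⟩, fun c =>
          (ih a (b + 1) (by omega) _ (hb c)).resolve_right (hc c)⟩
    · by_cases hc : ∃ c, ShattersTree {x ∈ Y | P x} {h ∈ H | h x = c} (a + 1)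
      · obtain ⟨c, hc⟩ := hc
        exact Or.inl (hc.mono_set fun g hg => hg.1)
      · push Not at hc
        refine Or.inr ⟨x, ⟨hx, hP⟩, fun c =>
          (ih (a + 1) b (by omega) _ ?_).resolve_left (hc c)⟩
        rw [show a + 1 + b = a + b + 1 by omega]
        exact hb c

/-- `p` functions of `H` and `p` points of `Y` with `h i (x j) = c` exactly when `i ≤ j`. -/
def HasChain {X : Type*} (c : Bool) (Y : Set X) (H : Set (X → Bool)) (p : ℕ) : Prop :=
  ∃ (x : Fin p → X) (h : Fin p → X → Bool), (∀ i, x i ∈ Y) ∧ (∀ i, h i ∈ H) ∧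
    ∀ i j : Fin p, h i (x j) = c ↔ i ≤ j

theorem HasChain.mono {X : Type*} {c : Bool} {Y Y' : Set X} {H H' : Set (X → Bool)} {p : ℕ}
    (h : HasChain c Y H p) (hY : Y ⊆ Y') (hH : H ⊆ H') : HasChain c Y' H' p := by
  obtain ⟨x, g, hx, hg, hxg⟩ := h
  exact ⟨x, g, fun i => hY (hx i), fun i => hH (hg i), hxg⟩

theorem HasChain.zero {X : Type*} (c : Bool) (Y : Set X) (H : Set (X → Bool)) :
    HasChain c Y H 0 :=
  ⟨Fin.elim0, Fin.elim0, fun i => i.elim0, fun i => i.elim0, fun i => i.elim0⟩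

theorem HasChain.cons {X : Type*} {c : Bool} {Y : Set X} {H : Set (X → Bool)} {p : ℕ}
    {g : X → Bool} (hg : g ∈ H) (hgY : ∀ y ∈ Y, g y = c) {x : X} (hx : x ∈ Y)
    (h : HasChain c Y {f ∈ H | f x = !c} p) : HasChain c Y H (p + 1) := by
  obtain ⟨y, f, hy, hf, hyf⟩ := h
  refine ⟨Fin.cons x y, Fin.cons g f, ?_, ?_, ?_⟩
  · intro i
    refine Fin.cases hx (fun i => hy i) i
  · intro i
    refine Fin.cases hg (fun i => (hf i).1) i
  · intro i j
    refine Fin.cases ?_ (fun i => ?_) i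
    · refine Fin.cases ?_ (fun j => ?_) j
      · simpa using hgY x hx
      · simpa using hgY _ (hy j)
    · refine Fin.cases ?_ (fun j => ?_) j
      · have h1 : f i x = !c := (hf i).2
        simp [h1]
      · simpa using hyf i j

theorem ShattersTree.hasChain {X : Type*} (n : ℕ) :
    ∀ (p q : ℕ), p + q = n → ∀ (Y : Set X) (H : Set (X → Bool)), ShattersTree Y H (4 ^ (p + q)) →
      HasChain true Y H p ∨ HasChain false Y H q := by
  induction n with
  | zero =>
    intro p q hpq Y H _
    obtain rfl : p = 0 := by omega
    exact Or.inl (.zero _ _ _)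
  | succ n ih =>
    intro p q hpq Y H h
    rcases p with _ | p
    · exact Or.inl (.zero _ _ _)
    rcases q with _ | q
    · exact Or.inr (.zero _ _ _)
    obtain ⟨g, hg⟩ := h.nonempty
    have hpow : (4 ^ (p + q + 1) + 1) + (4 ^ (p + q + 1) + 1) ≤ 4 ^ (p + 1 + (q + 1)) := by
      have : 0 < 4 ^ (p + q) := by positivity
      rw [show p + 1 + (q + 1) = p + q + 2 by omega, pow_succ, pow_succ, pow_succ]
      omega
    rcases ShattersTree.split (fun x => g x = true) _ _ _ rfl H (h.mono_depth hpow) with h | h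
    · obtain ⟨x, hx, hb⟩ := h
      rcases ih p (q + 1) (by omega) _ _ (hb false) with h | h
      · exact Or.inl ((h.cons hg (fun y hy => hy.2) hx).mono (fun y hy => hy.1) subset_rfl)
      · exact Or.inr (h.mono (fun y hy => hy.1) (fun y hy => hy.1))
    · obtain ⟨x, hx, hb⟩ := h
      rcases ih (p + 1) q (by omega) _ _
        (by rw [show p + 1 + q = p + q + 1 by omega]; exact hb true) with h | h
      · exact Or.inl (h.mono (fun y hy => hy.1) (fun y hy => hy.1))
      · exact Or.inr ((h.cons hg (fun y hy => by simpa using hy.2) hx).mono (fun y hy => hy.1)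
          subset_rfl)

theorem ContainsThresholds.mono {X : Type*} {H : Set (X → Bool)} {d d' : ℕ} (hd : d ≤ d')
    (h : ContainsThresholds H d') : ContainsThresholds H d := by
  obtain ⟨x, g, hg, hxg⟩ := h
  exact ⟨x ∘ Fin.castLE hd, g ∘ Fin.castLE hd, fun i => hg _, fun i j => hxg _ _⟩

/-- Large Littlestone dimension forces many thresholds. -/
theorem LdimGe.containsThresholds {X : Type*} {H : Set (X → Bool)} {d N : ℕ}
    (hd : 4 ^ (2 * N + 1) ≤ d) (h : LdimGe H d) : ContainsThresholds H N := by
  rcases ShattersTree.hasChain _ N (N + 1) rfl Set.univ H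
    (h.shattersTree.mono_depth (by rwa [show N + (N + 1) = 2 * N + 1 by omega])) with h | h
  · obtain ⟨x, g, -, hg, hxg⟩ := h
    exact ⟨x, g, hg, hxg⟩
  · obtain ⟨x, g, -, hg, hxg⟩ := h
    refine ⟨fun j => x ⟨N - 1 - j, by omega⟩, fun i => g ⟨N - i, by omega⟩, fun i => hg _,
      fun i j => ?_⟩
    have h1 := hxg ⟨N - i, by omega⟩ ⟨N - 1 - j, by omega⟩
    rw [← Bool.not_eq_false, h1, Fin.mk_le_mk]
    omega

/-- The `k`-fold iterated exponential of `x` in base two. -/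
def tower (k x : ℕ) : ℕ := (fun y => 2 ^ y)^[k] x

theorem tower_zero (x : ℕ) : tower 0 x = x := rfl

theorem tower_succ (k x : ℕ) : tower (k + 1) x = 2 ^ tower k x :=
  Function.iterate_succ_apply' _ _ _

theorem tower_add (k l x : ℕ) : tower (k + l) x = tower k (tower l x) :=
  Function.iterate_add_apply _ _ _ _

theorem tower_mono (k : ℕ) {x y : ℕ} (h : x ≤ y) : tower k x ≤ tower k y := by
  induction k with
  | zero => exact h
  | succ k ih =>
    rw [tower_succ, tower_succ]
    exact Nat.pow_le_pow_right (by norm_num) ih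

theorem add_le_tower (k x : ℕ) : x + k ≤ tower k x := by
  induction k with
  | zero => rfl
  | succ k ih =>
    rw [tower_succ]
    exact lt_of_le_of_lt ih Nat.lt_two_pow_self

theorem iterate_logb_le_one_of_le_tower (k : ℕ) :
    ∀ x : ℝ, x ≤ tower k 1 → ∃ j ≤ k, (fun y => Real.logb 2 y)^[j] x ≤ 1 := by
  induction k with
  | zero => exact fun x hx => ⟨0, le_rfl, by simpa [tower_zero] using hx⟩
  | succ k ih =>
    intro x hx
    by_cases h1 : x ≤ 1
    · exact ⟨0, Nat.zero_le _, h1⟩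
    · push Not at h1
      obtain ⟨j, hj, h⟩ := ih (Real.logb 2 x) (by
        rw [Real.logb_le_iff_le_rpow (by norm_num) (by linarith), Real.rpow_natCast]
        rw [tower_succ] at hx
        exact_mod_cast hx)
      exact ⟨j + 1, by omega, h⟩

theorem logStar_le_of_le_tower {k d : ℕ} (h : d ≤ tower k 1) : logStar (d : ℝ) ≤ k := by
  obtain ⟨j, hj, h⟩ := iterate_logb_le_one_of_le_tower k d (by exact_mod_cast h)
  exact (Nat.sInf_le h).trans hj

theorem ramseyBound_le_tower {q s M y : ℕ} (hq : q ≤ 2 ^ s) (hs : s ≤ y) (hM : M ≤ y)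
    (hy : 6 ≤ y) (r : ℕ) : ramseyBound q M r ≤ tower (3 * r) y := by
  induction r with
  | zero => exact hM
  | succ r ih =>
    rw [show 3 * (r + 1) = 3 * r + 1 + 1 + 1 by ring, tower_succ, tower_succ, tower_succ,
      ramseyBound]
    set z := tower (3 * r) y
    set n := ramseyBound q M r
    have hz : y ≤ z := (Nat.le_add_right _ _).trans (add_le_tower _ _)
    have h1 : z + 2 ≤ 2 ^ z := by
      have : z - 1 < 2 ^ (z - 1) := Nat.lt_two_pow_self
      have h2 : 2 ^ z = 2 * 2 ^ (z - 1) := by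
        rw [← pow_succ']
        congr 1
        omega
      omega
    have h2 : s * 2 ^ (z + 1) + 1 ≤ 2 ^ (2 * z + 1) := by
      have h3 : s + 1 ≤ 2 ^ z := by omega
      calc s * 2 ^ (z + 1) + 1 ≤ s * 2 ^ (z + 1) + 1 * 2 ^ (z + 1) := by
            have : 0 < 2 ^ (z + 1) := by positivity
            omega
        _ = (s + 1) * 2 ^ (z + 1) := by ring
        _ ≤ 2 ^ z * 2 ^ (z + 1) := Nat.mul_le_mul_right _ h3
        _ = 2 ^ (2 * z + 1) := by ring
    have h4 : 3 * z + 1 ≤ 2 ^ z := by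
      have : ∀ k, 3 * (k + 6) + 1 ≤ 2 ^ (k + 6) := by
        intro k
        induction k with
        | zero => norm_num
        | succ k ih =>
          rw [show k + 1 + 6 = (k + 6) + 1 by ring, pow_succ]
          omega
      have := this (z - 6)
      rwa [show z - 6 + 6 = z by omega] at this
    calc (2 * q ^ 2 ^ (n + 1)) ^ (n + 2)
        ≤ (2 * (2 ^ s) ^ 2 ^ (z + 1)) ^ (n + 2) := by
          gcongr
          · exact Nat.one_le_two_pow
          · norm_num
      _ ≤ (2 * (2 ^ s) ^ 2 ^ (z + 1)) ^ (z + 2) := by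
          apply Nat.pow_le_pow_right (by positivity)
          omega
      _ = 2 ^ ((s * 2 ^ (z + 1) + 1) * (z + 2)) := by
          rw [← pow_mul, ← pow_succ', ← pow_mul]
      _ ≤ 2 ^ (2 ^ 2 ^ z) := by
          apply Nat.pow_le_pow_right (by norm_num)
          calc (s * 2 ^ (z + 1) + 1) * (z + 2) ≤ 2 ^ (2 * z + 1) * 2 ^ z := Nat.mul_le_mul h2 h1
            _ = 2 ^ (3 * z + 1) := by ring
            _ ≤ 2 ^ 2 ^ z := Nat.pow_le_pow_right (by norm_num) h4

theorem ramseyBound_sample_le_tower (m : ℕ) :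
    ramseyBound ((1000 * m ^ 2 + 1) ^ (2 ^ (m + 1) * (m + 2) ^ (m + 2))) (3000 * m ^ 3) (m + 2)
      ≤ tower (4 * m + 12) 1 := by
  set y := 2 ^ 2 ^ (m + 14) with hy
  have hpow : ∀ k : ℕ, k < 2 ^ k := fun k => Nat.lt_two_pow_self
  have hquad : m ^ 2 + 7 * m + 16 ≤ 2 ^ (m + 14) := by
    induction m with
    | zero => norm_num
    | succ k ih =>
      rw [show k + 1 + 14 = (k + 14) + 1 by ring, pow_succ 2]
      have := ih rfl
      have h2 := hpow k
      have h3 : 2 ^ (k + 14) = 2 ^ k * 16384 := by rw [pow_add]; norm_num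
      nlinarith
  have hQ : 1000 * m ^ 2 + 1 ≤ 2 ^ (2 * m + 10) := by
    have : m ^ 2 + 1 ≤ 2 ^ (2 * m) := by
      rw [pow_mul']
      have := hpow m
      nlinarith
    calc 1000 * m ^ 2 + 1 ≤ (m ^ 2 + 1) * 1024 := by nlinarith
      _ ≤ 2 ^ (2 * m) * 1024 := Nat.mul_le_mul_right _ this
      _ = 2 ^ (2 * m + 10) := by ring
  have hexp : 2 ^ (m + 1) * (m + 2) ^ (m + 2) ≤ 2 ^ (m ^ 2 + 4 * m + 5) := by
    have : m + 2 ≤ 2 ^ (m + 1) := hpow (m + 1)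
    calc 2 ^ (m + 1) * (m + 2) ^ (m + 2) ≤ 2 ^ (m + 1) * (2 ^ (m + 1)) ^ (m + 2) :=
          Nat.mul_le_mul_left _ (Nat.pow_le_pow_left this _)
      _ = 2 ^ (m ^ 2 + 4 * m + 3) := by rw [← pow_mul, ← pow_add]; ring_nf
      _ ≤ _ := Nat.pow_le_pow_right (by norm_num) (by omega)
  have hlin : 2 * m + 10 ≤ 2 ^ (m + 10) := by
    have := hpow m
    rw [pow_add]
    omega
  have h := ramseyBound_le_tower (q := (1000 * m ^ 2 + 1) ^ (2 ^ (m + 1) * (m + 2) ^ (m + 2)))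
    (s := (2 * m + 10) * (2 ^ (m + 1) * (m + 2) ^ (m + 2))) (M := 3000 * m ^ 3) (y := y)
    (by
      rw [pow_mul 2]
      exact Nat.pow_le_pow_left hQ _)
    (by
      calc (2 * m + 10) * (2 ^ (m + 1) * (m + 2) ^ (m + 2))
          ≤ 2 ^ (m + 10) * 2 ^ (m ^ 2 + 4 * m + 5) := Nat.mul_le_mul hlin hexp
        _ = 2 ^ (m ^ 2 + 5 * m + 15) := by rw [← pow_add]; ring_nf
        _ ≤ y := Nat.pow_le_pow_right (by norm_num) (by omega))
    (by
      have h1 := (hpow m).le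
      calc 3000 * m ^ 3 ≤ 4096 * (2 ^ m) ^ 3 := by gcongr; norm_num
        _ = 2 ^ (3 * m + 12) := by rw [← pow_mul, pow_add]; ring
        _ ≤ y := Nat.pow_le_pow_right (by norm_num) (by nlinarith))
    (by
      calc 6 ≤ 2 ^ 4 := by norm_num
        _ ≤ y := Nat.pow_le_pow_right (by norm_num) (by nlinarith)) (m + 2)
  refine h.trans ?_
  rw [show 4 * m + 12 = 3 * (m + 2) + (m + 2 + 4) by ring, tower_add]
  apply tower_mono
  rw [show m + 2 + 4 = m + 4 + 1 + 1 by ring, tower_succ, tower_succ, hy]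
  apply Nat.pow_le_pow_right (by norm_num)
  apply Nat.pow_le_pow_right (by norm_num)
  rw [tower_add]
  have h4 : tower 4 1 = 65536 := by norm_num [tower_succ, tower_zero]
  rw [h4]
  exact le_trans (by omega) (add_le_tower m 65536)

/-- The expectation of `f` under the probability mass function `p`. -/
noncomputable def expect {Ω : Type*} (p f : Ω → ℝ) : ℝ := ∑' a, p a * f a

namespace IsProbMass

variable {Ω : Type*} {p q f g : Ω → ℝ} {B ε δ : ℝ}

theorem summable_mul (hp : IsProbMass p) (hf : ∀ a, |f a| ≤ B) :
    Summable (fun a => p a * f a) := by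
  refine Summable.of_norm_bounded (g := fun a => p a * B) (hp.2.summable.mul_right B) fun a => ?_
  rw [Real.norm_eq_abs, abs_mul, abs_of_nonneg (hp.1 a)]
  exact mul_le_mul_of_nonneg_left (hf a) (hp.1 a)

theorem expect_const (hp : IsProbMass p) (c : ℝ) : expect p (fun _ => c) = c := by
  rw [expect, tsum_mul_right, hp.2.tsum_eq, one_mul]

theorem expect_mono (hp : IsProbMass p) {B' : ℝ} (hf : ∀ a, |f a| ≤ B) (hg : ∀ a, |g a| ≤ B')
    (h : ∀ a, f a ≤ g a) : expect p f ≤ expect p g :=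
  (hp.summable_mul hf).tsum_le_tsum (fun a => mul_le_mul_of_nonneg_left (h a) (hp.1 a))
    (hp.summable_mul hg)

theorem expect_add (hp : IsProbMass p) {B' : ℝ} (hf : ∀ a, |f a| ≤ B) (hg : ∀ a, |g a| ≤ B') :
    expect p (fun a => f a + g a) = expect p f + expect p g := by
  simp only [expect, mul_add]
  exact (hp.summable_mul hf).tsum_add (hp.summable_mul hg)

theorem expect_const_mul (p f : Ω → ℝ) (c : ℝ) :
    expect p (fun a => c * f a) = c * expect p f := by
  simp only [expect, mul_left_comm _ c]
  exact tsum_mul_left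

theorem expect_sum (hp : IsProbMass p) {ι : Type*} (s : Finset ι) {F : ι → Ω → ℝ}
    (hF : ∀ i ∈ s, ∀ a, |F i a| ≤ B) :
    expect p (fun a => ∑ i ∈ s, F i a) = ∑ i ∈ s, expect p (F i) := by
  simp only [expect, Finset.mul_sum]
  exact Summable.tsum_finsetSum fun i hi => hp.summable_mul (hF i hi)

theorem expect_nonneg (hp : IsProbMass p) (hf : ∀ a, 0 ≤ f a) : 0 ≤ expect p f :=
  tsum_nonneg fun a => mul_nonneg (hp.1 a) (hf a)

theorem expect_le_one (hp : IsProbMass p) (h0 : ∀ a, 0 ≤ f a) (h1 : ∀ a, f a ≤ 1) :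
    expect p f ≤ 1 := by
  rw [← hp.expect_const 1]
  exact hp.expect_mono (fun a => abs_le.mpr ⟨by linarith [h0 a], h1 a⟩) (B' := 1) (by simp) h1

theorem sq_expect_le (hp : IsProbMass p) (hf : ∀ a, |f a| ≤ B) :
    expect p f ^ 2 ≤ expect p (fun a => f a ^ 2) := by
  set c := expect p f with hc
  have hsq : ∀ a, |f a ^ 2| ≤ B ^ 2 := fun a => by
    rw [abs_pow]
    exact pow_le_pow_left₀ (abs_nonneg _) (hf a) 2
  have h2 : ∀ a, |-2 * c * f a| ≤ |2 * c| * B := fun a => by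
    rw [abs_mul, neg_mul, abs_neg]
    exact mul_le_mul_of_nonneg_left (hf a) (abs_nonneg _)
  have h3 : ∀ a, |f a ^ 2 + -2 * c * f a| ≤ B ^ 2 + |2 * c| * B := fun a =>
    (abs_add_le _ _).trans (add_le_add (hsq a) (h2 a))
  have h := hp.expect_nonneg (f := fun a => f a ^ 2 + -2 * c * f a + c ^ 2)
    fun a => by nlinarith [sq_nonneg (f a - c)]
  rw [hp.expect_add h3 (B' := c ^ 2) (by simp), hp.expect_add hsq h2, expect_const_mul,
    hp.expect_const, ← hc] at h
  nlinarith

theorem massProb_eq_expect (p : Ω → ℝ) (E : Set Ω) :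
    massProb p E = expect p (E.indicator fun _ => 1) := by
  refine tsum_congr fun a => ?_
  by_cases h : a ∈ E <;> simp [h]

end IsProbMass

theorem Indist.expect_le {Ω : Type*} {p q f : Ω → ℝ} {ε δ : ℝ} (h : Indist p q ε δ)
    (hp : IsProbMass p) (hq : IsProbMass q) (h0 : ∀ a, 0 ≤ f a) (h1 : ∀ a, f a ≤ 1) :
    expect p f ≤ Real.exp ε * expect q f + δ := by
  have hf : ∀ a, |f a| ≤ 1 := fun a => abs_le.mpr ⟨by linarith [h0 a], h1 a⟩
  let E : Set Ω := {a | Real.exp ε * q a < p a}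
  have hE : ∀ a, |E.indicator (fun _ => (1 : ℝ)) a| ≤ 1 := fun a => by
    by_cases h : a ∈ E <;> simp [h]
  have key := (h E).1
  rw [IsProbMass.massProb_eq_expect, IsProbMass.massProb_eq_expect] at key
  have s1 := hp.summable_mul hf
  have s2 := (hq.summable_mul hf).mul_left (Real.exp ε)
  have s3 := hp.summable_mul hE
  have s4 := (hq.summable_mul hE).mul_left (Real.exp ε)
  have : expect p f - Real.exp ε * expect q f ≤
      expect p (E.indicator fun _ => 1) - Real.exp ε * expect q (E.indicator fun _ => 1) := by
    simp only [expect, ← tsum_mul_left]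
    rw [← s1.tsum_sub s2, ← s3.tsum_sub s4]
    refine (s1.sub s2).tsum_le_tsum (fun a => ?_) (s3.sub s4)
    by_cases ha : a ∈ E
    · have ha' : Real.exp ε * q a < p a := ha
      simp only [ha, Set.indicator_of_mem]
      nlinarith [h0 a, h1 a]
    · have ha' : p a ≤ Real.exp ε * q a := not_lt.mp ha
      simp only [ha, not_false_eq_true, Set.indicator_of_notMem]
      nlinarith [h0 a, h1 a]
  linarith

/-- A private mechanism cannot separate in mean two blocks of events that look exchangeable under
a neighbouring distribution. -/
theorem Indist.block_separation_le {Ω : Type*} {p q : Ω → ℝ} {ε δ η κ c : ℝ}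
    (h : Indist p q ε δ) (hp : IsProbMass p) (hq : IsProbMass q) (v : ℕ → Ω → ℝ)
    (hv0 : ∀ x a, 0 ≤ v x a) (hv1 : ∀ x a, v x a ≤ 1) (b : ℕ) (hb : 0 < b)
    (pos : Fin b × Bool → ℕ) (hη : 0 ≤ η)
    (hsep : ∀ s, η ≤ expect p (v (pos (s, true))) - expect p (v (pos (s, false))))
    (hc : 0 ≤ c)
    (hexch : ∀ z z', z ≠ z' → |expect q (fun a => v (pos z) a * v (pos z') a) - c| ≤ κ)
    (hκ : 0 ≤ κ) :
    η ^ 2 ≤ Real.exp ε * (2 / b + 4 * κ) + δ := by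
  let sg : Bool → ℝ := fun t => if t then 1 else -1
  have hsg : ∀ t, |sg t| = 1 := fun t => by cases t <;> simp [sg]
  let f : Ω → ℝ := fun a => ∑ z : Fin b × Bool, sg z.2 * v (pos z) a
  have hb' : (0 : ℝ) < b := by exact_mod_cast hb
  have hva : ∀ x a, |v x a| ≤ 1 := fun x a => abs_le.mpr ⟨by linarith [hv0 x a], hv1 x a⟩
  have hterm : ∀ (z : Fin b × Bool) a, |sg z.2 * v (pos z) a| ≤ 1 := fun z a => by
    rw [abs_mul, hsg, one_mul]
    exact hva _ _
  have hf_eq : ∀ a, f a = ∑ s : Fin b, (v (pos (s, true)) a - v (pos (s, false)) a) := fun a => by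
    simp only [f, Fintype.sum_prod_type, Fintype.sum_bool, sg]
    refine Finset.sum_congr rfl fun s _ => ?_
    simp
    ring
  have hf : ∀ a, |f a| ≤ b := fun a => by
    rw [hf_eq]
    refine (Finset.abs_sum_le_sum_abs _ _).trans ?_
    refine (Finset.sum_le_sum (g := fun _ => (1 : ℝ)) fun s _ => ?_).trans (by simp)
    rw [abs_le]
    constructor <;> linarith [hv0 (pos (s, true)) a, hv0 (pos (s, false)) a,
      hv1 (pos (s, true)) a, hv1 (pos (s, false)) a]
  have hfp : b * η ≤ expect p f := by
    simp only [f]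
    rw [hp.expect_sum _ fun z _ => hterm z, Fintype.sum_prod_type]
    simp only [IsProbMass.expect_const_mul, Fintype.sum_bool]
    calc b * η = ∑ _s : Fin b, η := by simp
      _ ≤ _ := Finset.sum_le_sum fun s _ => by
        have := hsep s
        simp only [sg]
        simp
        linarith
  have hfp2 : (b * η) ^ 2 ≤ expect p (fun a => f a ^ 2) :=
    (pow_le_pow_left₀ (by positivity) hfp 2).trans (hp.sq_expect_le hf)
  have hfq : expect q (fun a => f a ^ 2) ≤ 2 * b + 4 * b ^ 2 * κ := by
    have h1 : ∀ a, f a ^ 2 = ∑ z : Fin b × Bool, ∑ z' : Fin b × Bool,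
        (sg z.2 * sg z'.2) * (v (pos z) a * v (pos z') a) := fun a => by
      simp only [f]
      rw [sq, Finset.sum_mul_sum]
      refine Finset.sum_congr rfl fun z _ => Finset.sum_congr rfl fun z' _ => ?_
      ring
    have hvv : ∀ z z' a, |(sg z.2 * sg z'.2) * (v (pos z) a * v (pos z') a)| ≤ 1 :=
      fun z z' a => by
        rw [abs_mul, abs_mul, hsg, hsg, one_mul, one_mul, abs_mul]
        exact mul_le_one₀ (hva _ _) (abs_nonneg _) (hva _ _)
    have h2 : expect q (fun a => f a ^ 2) = ∑ z : Fin b × Bool, ∑ z' : Fin b × Bool,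
        (sg z.2 * sg z'.2) * expect q (fun a => v (pos z) a * v (pos z') a) := by
      simp only [h1]
      rw [hq.expect_sum (B := ∑ _z' : Fin b × Bool, (1 : ℝ)) _ fun z _ a =>
        (Finset.abs_sum_le_sum_abs _ _).trans (Finset.sum_le_sum fun z' _ => hvv z z' a)]
      refine Finset.sum_congr rfl fun z _ => ?_
      rw [hq.expect_sum _ fun z' _ => hvv z z']
      refine Finset.sum_congr rfl fun z' _ => ?_
      rw [IsProbMass.expect_const_mul]
    rw [h2]
    calc _ ≤ ∑ z : Fin b × Bool, ∑ z' : Fin b × Bool,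
          ((sg z.2 * sg z'.2) * c + κ + if z = z' then 1 else 0) := by
          refine Finset.sum_le_sum fun z _ => Finset.sum_le_sum fun z' _ => ?_
          by_cases hz : z = z'
          · subst hz
            have h3 : sg z.2 * sg z.2 = 1 := by cases z.2 <;> simp [sg]
            have h4 := hq.expect_le_one (f := fun a => v (pos z) a * v (pos z) a)
              (fun a => mul_nonneg (hv0 _ _) (hv0 _ _))
              (fun a => mul_le_one₀ (hv1 _ _) (hv0 _ _) (hv1 _ _))
            simp only [h3, if_true]
            linarith
          · simp only [hz, if_false, add_zero]
            have h3 : |(sg z.2 * sg z'.2) *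
                (expect q (fun a => v (pos z) a * v (pos z') a) - c)| ≤ κ := by
              rw [abs_mul, abs_mul, hsg, hsg, one_mul, one_mul]
              exact hexch z z' hz
            have := (abs_le.mp h3).2
            linarith
      _ = (∑ z : Fin b × Bool, sg z.2) ^ 2 * c + (2 * b) ^ 2 * κ + 2 * b := by
          simp only [Finset.sum_add_distrib, ← Finset.sum_mul, Finset.sum_ite_eq,
            Finset.mem_univ, if_true, Finset.sum_const, Finset.card_univ, Fintype.card_prod,
            Fintype.card_fin, Fintype.card_bool, nsmul_eq_mul, sq, Finset.sum_mul_sum]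
          push_cast
          ring
      _ = 2 * b + 4 * b ^ 2 * κ := by
          have : ∑ z : Fin b × Bool, sg z.2 = 0 := by
            simp [Fintype.sum_prod_type, sg]
          rw [this]
          ring
  have hpriv := h.expect_le hp hq (f := fun a => (f a / b) ^ 2) (fun a => sq_nonneg _) fun a => by
    rw [sq_le_one_iff_abs_le_one, abs_div, abs_of_pos hb']
    exact div_le_one_of_le₀ (hf a) hb'.le
  have hdiv : ∀ r : Ω → ℝ, expect r (fun a => (f a / b) ^ 2)
      = (1 / b ^ 2) * expect r (fun a => f a ^ 2) := fun r => by
    rw [← IsProbMass.expect_const_mul]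
    congr 1
    funext a
    rw [div_pow]
    ring
  rw [hdiv, hdiv] at hpriv
  have e1 : η ^ 2 ≤ 1 / b ^ 2 * expect p (fun a => f a ^ 2) := by
    rw [one_div, ← div_eq_inv_mul, le_div_iff₀ (by positivity)]
    linarith
  have e2 : 1 / b ^ 2 * expect q (fun a => f a ^ 2) ≤ 2 / b + 4 * κ := by
    rw [one_div, ← div_eq_inv_mul, div_le_iff₀ (by positivity)]
    have : (2 / b + 4 * κ) * (b : ℝ) ^ 2 = 2 * b + 4 * b ^ 2 * κ := by
      field_simp
    linarith
  have e3 := mul_le_mul_of_nonneg_left e2 (Real.exp_pos ε).le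
  linarith

open Classical in
/-- The mass function of a uniformly chosen entry of `z`. -/
noncomputable def uniformMass {Y : Type*} {k : ℕ} (z : Fin k → Y) : Y → ℝ :=
  fun y => ∑ j, if y = z j then 1 / (k : ℝ) else 0

section uniformMass

variable {Y : Type*} {k : ℕ} (z : Fin k → Y)

theorem uniformMass_nonneg (y : Y) : 0 ≤ uniformMass z y := by
  classical
  exact Finset.sum_nonneg fun j _ => by split_ifs <;> positivity

theorem massProb_uniformMass (E : Set Y) :
    massProb (uniformMass z) E = (∑ j, E.indicator (fun _ => (1 : ℝ)) (z j)) / k := by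
  classical
  have h : HasSum (E.indicator (uniformMass z))
      (∑ j, if z j ∈ E then 1 / (k : ℝ) else 0) := by
    have h1 : E.indicator (uniformMass z) =
        fun y => ∑ j, if y = z j then (if z j ∈ E then 1 / (k : ℝ) else 0) else 0 := by
      funext y
      by_cases hy : y ∈ E
      · rw [Set.indicator_of_mem hy, uniformMass]
        refine Finset.sum_congr rfl fun j _ => ?_
        by_cases hj : y = z j
        · simp [← hj, hy]
        · simp [hj]
      · rw [Set.indicator_of_notMem hy]
        refine (Finset.sum_eq_zero fun j _ => ?_).symm
        by_cases hj : y = z j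
        · simp [← hj, hy]
        · simp [hj]
    rw [h1]
    exact hasSum_sum fun j _ => hasSum_ite_eq (z j) _
  rw [massProb, h.tsum_eq, Finset.sum_div]
  exact Finset.sum_congr rfl fun j _ => by by_cases hj : z j ∈ E <;> simp [hj]

theorem isProbMass_uniformMass (hk : 0 < k) : IsProbMass (uniformMass z) := by
  classical
  refine ⟨uniformMass_nonneg z, ?_⟩
  have h : HasSum (uniformMass z) (∑ _j : Fin k, 1 / (k : ℝ)) :=
    hasSum_sum fun j _ => hasSum_ite_eq (z j) _
  have hk' : (k : ℝ) ≠ 0 := by exact_mod_cast hk.ne'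
  simpa [hk'] using h

theorem one_div_le_uniformMass (j : Fin k) : 1 / (k : ℝ) ≤ uniformMass z (z j) := by
  classical
  refine le_trans ?_ (Finset.single_le_sum (f := fun i => if z j = z i then 1 / (k : ℝ) else 0)
    (fun i _ => by split_ifs <;> positivity) (Finset.mem_univ j))
  simp

theorem uniformMass_eq_zero {y : Y} (hy : y ∉ Set.range z) : uniformMass z y = 0 := by
  classical
  refine Finset.sum_eq_zero fun j _ => if_neg ?_
  rintro rfl
  exact hy ⟨j, rfl⟩

end uniformMass

theorem pow_le_two_mul_descFactorial {k m : ℕ} (hk : 2 * m ^ 2 ≤ k) :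
    (k : ℝ) ^ m ≤ 2 * (k.descFactorial m : ℝ) := by
  rcases Nat.eq_zero_or_pos m with rfl | hm
  · norm_num
  have hmk : m ≤ k := by nlinarith
  have hk0 : (0 : ℝ) < k := by exact_mod_cast lt_of_lt_of_le hm hmk
  have h1 : ((k : ℝ) - m) ^ m ≤ (k.descFactorial m : ℝ) := by
    rw [← Nat.cast_sub hmk]
    exact_mod_cast (Nat.pow_le_pow_left (by omega : k - m ≤ k + 1 - m) m).trans
      (Nat.pow_sub_le_descFactorial k m)
  have hmk' : (m : ℝ) / k ≤ 1 := div_le_one_of_le₀ (by exact_mod_cast hmk) hk0.le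
  have h2 := one_add_mul_le_pow (a := -((m : ℝ) / k)) (by linarith) m
  have h3 : (m : ℝ) * (m / k) ≤ 1 / 2 := by
    rw [← mul_div_assoc, div_le_div_iff₀ hk0 (by norm_num)]
    have : (2 : ℝ) * m ^ 2 ≤ k := by exact_mod_cast hk
    nlinarith
  have h4 : ((k : ℝ) - m) ^ m = k ^ m * (1 + -((m : ℝ) / k)) ^ m := by
    rw [← mul_pow]
    congr 1
    field_simp
    ring
  have h5 : (0 : ℝ) < (k : ℝ) ^ m := by positivity
  nlinarith

/-- A sample of distinct examples on which a rarely failing learner rarely fails. -/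
theorem exists_injective_sample {Y Ω : Type*} {k m : ℕ} {z : Fin k → Y}
    (hz : Function.Injective z) (hk0 : 0 < k) (hk : 2 * m ^ 2 ≤ k)
    {A : (Fin m → Y) → Ω → ℝ} (hA : ∀ S, IsProbMass (A S)) {B : Set Ω} {β : ℝ} (hβ : 0 ≤ β)
    (h : massProb (fun Sh : (Fin m → Y) × Ω => (∏ i, uniformMass z (Sh.1 i)) * A Sh.1 Sh.2)
      {Sh | Sh.2 ∈ B} ≤ β) :
    ∃ I : Fin m → Fin k, Function.Injective I ∧ massProb (A (z ∘ I)) B ≤ 2 * β := by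
  classical
  by_contra! hcon
  have hk0' : (0 : ℝ) < k := by exact_mod_cast hk0
  let F : (Fin m → Y) × Ω → ℝ :=
    fun Sh => (∏ i, uniformMass z (Sh.1 i)) * B.indicator (A Sh.1) Sh.2
  have hprod : ∀ S : Fin m → Y, 0 ≤ ∏ i, uniformMass z (S i) := fun S =>
    Finset.prod_nonneg fun i _ => uniformMass_nonneg z _
  have hind : ∀ S a, 0 ≤ B.indicator (A S) a := fun S a =>
    Set.indicator_nonneg (fun a _ => (hA S).1 a) a
  have hF0 : 0 ≤ F := fun Sh => mul_nonneg (hprod _) (hind _ _)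
  have hFeq : massProb (fun Sh : (Fin m → Y) × Ω =>
      (∏ i, uniformMass z (Sh.1 i)) * A Sh.1 Sh.2) {Sh | Sh.2 ∈ B} = ∑' Sh, F Sh := by
    rw [massProb]
    refine tsum_congr fun Sh => ?_
    by_cases hB : Sh.2 ∈ B
    · rw [Set.indicator_of_mem (show Sh ∈ {Sh : (Fin m → Y) × Ω | Sh.2 ∈ B} from hB)]
      simp only [F, Set.indicator_of_mem hB]
    · rw [Set.indicator_of_notMem (show Sh ∉ {Sh : (Fin m → Y) × Ω | Sh.2 ∈ B} from hB)]
      simp only [F, Set.indicator_of_notMem hB, mul_zero]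
  have hsumS : ∀ S, Summable fun a => F (S, a) := fun S =>
by
    simp only [F]
    exact ((hA S).2.summable.indicator B).mul_left _
  have htsumS : ∀ S, ∑' a, F (S, a) = (∏ i, uniformMass z (S i)) * massProb (A S) B :=
    fun S => by
      simp only [F, massProb]
      exact tsum_mul_left
  have hmass0 : ∀ S, 0 ≤ massProb (A S) B := fun S => tsum_nonneg (hind S)
  have hfin : Summable fun S => ∑' a, F (S, a) := by
    apply summable_of_hasFiniteSupport
    refine (Set.Finite.pi' (fun _ : Fin m => Set.finite_range z)).subset fun S hS => ?_
    intro i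
    by_contra hi
    refine hS ?_
    simp only
    rw [htsumS, Finset.prod_eq_zero (Finset.mem_univ i) (uniformMass_eq_zero z hi), zero_mul]
  have hF : Summable F := (summable_prod_of_nonneg hF0).mpr ⟨hsumS, hfin⟩
  rw [hFeq, hF.tsum_prod] at h
  let emb : (Fin m ↪ Fin k) → Fin m → Y := fun I => z ∘ I
  have hemb : Function.Injective emb := fun I J hIJ =>
    DFunLike.coe_injective (hz.comp_left hIJ)
  have hle := hfin.sum_le_tsum (Finset.univ.image emb) fun S _ => by
    rw [htsumS]
    exact mul_nonneg (hprod S) (hmass0 S)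
  rw [Finset.sum_image fun I _ J _ hIJ => hemb hIJ] at hle
  have hlow : ∀ I : Fin m ↪ Fin k, (1 / (k : ℝ)) ^ m * (2 * β) < ∑' a, F (emb I, a) := by
    intro I
    rw [htsumS]
    have h1 : (1 / (k : ℝ)) ^ m ≤ ∏ i, uniformMass z (emb I i) := by
      calc (1 / (k : ℝ)) ^ m = ∏ _i : Fin m, 1 / (k : ℝ) := by simp
        _ ≤ _ := Finset.prod_le_prod (fun _ _ => by positivity)
          fun i _ => one_div_le_uniformMass z _
    have h2 := hcon I I.injective
    have h3 : (0 : ℝ) < (1 / (k : ℝ)) ^ m := by positivity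
    calc (1 / (k : ℝ)) ^ m * (2 * β) < (1 / (k : ℝ)) ^ m * massProb (A (emb I)) B :=
          mul_lt_mul_of_pos_left h2 h3
      _ ≤ _ := mul_le_mul_of_nonneg_right h1 (hmass0 _)
  have hmk : m ≤ k := by
    rcases Nat.eq_zero_or_pos m with rfl | hm
    · omega
    · nlinarith
  have hne : (Finset.univ : Finset (Fin m ↪ Fin k)).Nonempty :=
    ⟨Fin.castLEEmb hmk, Finset.mem_univ _⟩
  have hlt := Finset.sum_lt_sum_of_nonempty hne fun I _ => hlow I
  rw [Finset.sum_const, Finset.card_univ, Fintype.card_embedding_eq, Fintype.card_fin,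
    Fintype.card_fin, nsmul_eq_mul] at hlt
  have hd : (k : ℝ) ^ m ≤ 2 * (k.descFactorial m : ℝ) := pow_le_two_mul_descFactorial hk
  have hβ' : β ≤ (k.descFactorial m : ℝ) * ((1 / (k : ℝ)) ^ m * (2 * β)) := by
    have h5 : (0 : ℝ) < (k : ℝ) ^ m := by positivity
    have h6 : (k.descFactorial m : ℝ) * ((1 / (k : ℝ)) ^ m * (2 * β))
        = (2 * (k.descFactorial m : ℝ)) * β / (k : ℝ) ^ m := by
      rw [one_div, inv_pow]
      field_simp
    rw [h6, le_div_iff₀ h5, mul_comm]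
    exact mul_le_mul_of_nonneg_right hd hβ
  linarith

open Classical in
/-- The indicator of the hypotheses that label `x` positively. -/
noncomputable def posInd {X : Type*} (x : X) (f : X → Bool) : ℝ := if f x = true then 1 else 0

theorem posInd_nonneg {X : Type*} (x : X) (f : X → Bool) : 0 ≤ posInd x f := by
  unfold posInd
  split_ifs <;> norm_num

theorem posInd_le_one {X : Type*} (x : X) (f : X → Bool) : posInd x f ≤ 1 := by
  unfold posInd
  split_ifs <;> norm_num

theorem abs_posInd_le {X : Type*} (x : X) (f : X → Bool) : |posInd x f| ≤ 1 :=
  abs_le.mpr ⟨by linarith [posInd_nonneg x f], posInd_le_one x f⟩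

/-- On some sample of distinct points, an accurate learner separates in mean two unseen points. -/
theorem AccurateLearner.exists_separated_points {X : Type*} {m : ℕ} {H : Set (X → Bool)}
    {A : (Fin m → X × Bool) → (X → Bool) → ℝ} (hA : ∀ S, IsProbMass (A S))
    (hacc : AccurateLearner H A (1 / 16) (1 / 16)) (x : ℕ → X) (n : ℕ) (hn : 4 * m < n)
    (hmn : m ^ 2 ≤ n) (hinj : ∀ i < 2 * n, ∀ j < 2 * n, x i = x j → i = j)
    {h : X → Bool} (hH : h ∈ H) (hx : ∀ j < 2 * n, h (x j) = decide (n ≤ j)) :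
    ∃ I : Fin m → ℕ, Function.Injective I ∧ (∀ i, I i < 2 * n) ∧ ∃ lo hi, lo < hi ∧ hi < 2 * n ∧
      (∀ i, I i ≠ lo) ∧ (∀ i, I i ≠ hi) ∧
      1 / 2 ≤ expect (A fun i => (x (I i), decide (n ≤ I i))) (posInd (x hi)) -
        expect (A fun i => (x (I i), decide (n ≤ I i))) (posInd (x lo)) := by
  classical
  let z : Fin (2 * n) → X × Bool := fun j => (x j, decide (n ≤ (j : ℕ)))
  have hz : Function.Injective z := fun i j hij =>
    Fin.ext (hinj i i.2 j j.2 (congrArg Prod.fst hij))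
  let B : Set (X → Bool) := {f | 1 / 16 < massProb (uniformMass z) {p | f p.1 ≠ p.2}}
  have hn0 : (0 : ℝ) < n := by exact_mod_cast (by omega : 0 < n)
  obtain ⟨I, hI, hIB⟩ := exists_injective_sample (A := A) (B := B) (β := 1 / 16) hz (by omega)
    (by omega) hA (by norm_num) (hacc (uniformMass z) (isProbMass_uniformMass z (by omega))
      ⟨h, hH, by
        rw [massProb_uniformMass]
        have : ∀ j, z j ∉ {p : X × Bool | h p.1 ≠ p.2} := fun j => by
          simpa [z] using hx j j.2
        simp [this]⟩)
  set p := A (z ∘ I) with hp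
  have hpm : IsProbMass p := hA _
  let e : ℕ → ℝ := fun j => expect p (posInd (x j))
  have he0 : ∀ j, 0 ≤ e j := fun j => hpm.expect_nonneg (posInd_nonneg _)
  have he1 : ∀ j, e j ≤ 1 := fun j => hpm.expect_le_one (posInd_nonneg _) (posInd_le_one _)
  let er : ℕ → (X → Bool) → ℝ := fun j f => posInd (x j) f + (1 - posInd (x (n + j)) f)
  have her : ∀ j f, |er j f| ≤ 2 := fun j f => abs_le.mpr
    ⟨by simp only [er]; linarith [posInd_nonneg (x j) f, posInd_le_one (x (n + j)) f],
      by simp only [er]; linarith [posInd_le_one (x j) f, posInd_nonneg (x (n + j)) f]⟩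
  have hexp : ∀ j, expect p (er j) = e j + (1 - e (n + j)) := fun j => by
    have h1 := hpm.expect_add (f := fun _ => 1) (g := fun f => -1 * posInd (x (n + j)) f)
      (B := 1) (B' := 1) (by simp) (fun f => by simpa using abs_posInd_le (x (n + j)) f)
    rw [IsProbMass.expect_const_mul, hpm.expect_const] at h1
    have h2 := hpm.expect_add (f := posInd (x j))
      (g := fun f => 1 + -1 * posInd (x (n + j)) f) (B := 1) (B' := 1) (abs_posInd_le _)
      (fun f => abs_le.mpr ⟨by linarith [posInd_le_one (x (n + j)) f],
        by linarith [posInd_nonneg (x (n + j)) f]⟩)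
    rw [h1] at h2
    have h3 : er j = fun f => posInd (x j) f + (1 + -1 * posInd (x (n + j)) f) := by
      funext f
      simp only [er]
      ring
    rw [h3, h2]
    simp only [e]
    ring
  have hloss : ∀ f : X → Bool, massProb (uniformMass z) {p | f p.1 ≠ p.2}
      = (∑ j ∈ Finset.range n, er j f) / (2 * n) := fun f => by
    rw [massProb_uniformMass]
    have h1 : ∀ j : Fin (2 * n), {p : X × Bool | f p.1 ≠ p.2}.indicator (fun _ => (1 : ℝ)) (z j)
        = (fun j : ℕ => if n ≤ j then 1 - posInd (x j) f else posInd (x j) f) j := fun j => by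
      by_cases hj : n ≤ (j : ℕ) <;> by_cases hf : f (x j) = true <;> simp [z, posInd, hj, hf]
    rw [Finset.sum_congr rfl fun j _ => h1 j, Fin.sum_univ_eq_sum_range
      (fun j : ℕ => if n ≤ j then 1 - posInd (x j) f else posInd (x j) f), two_mul,
      Finset.sum_range_add, Finset.sum_add_distrib]
    push_cast
    rw [← two_mul]
    congr 2
    · exact Finset.sum_congr rfl fun j hj => if_neg (not_le.mpr (Finset.mem_range.mp hj))
    · exact Finset.sum_congr rfl fun j _ => if_pos (Nat.le_add_right _ _)
  have hsum0 : ∀ f, 0 ≤ ∑ j ∈ Finset.range n, er j f := fun f => Finset.sum_nonneg fun j _ => by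
    simp only [er]
    linarith [posInd_nonneg (x j) f, posInd_le_one (x (n + j)) f]
  have hsum2 : ∀ f, ∑ j ∈ Finset.range n, er j f ≤ 2 * n := fun f => by
    refine (Finset.sum_le_sum fun j _ => (abs_le.mp (her j f)).2).trans ?_
    simp [mul_comm]
  have hind : ∀ f, |2 * n * B.indicator (fun _ => (1 : ℝ)) f| ≤ 2 * n := fun f => by
    by_cases hf : f ∈ B <;> simp [hf, abs_of_pos hn0]
  have htot : ∑ j ∈ Finset.range n, (e j + (1 - e (n + j))) ≤ 3 / 8 * n := by
    have h1 := hpm.expect_mono (f := fun f => ∑ j ∈ Finset.range n, er j f)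
      (g := fun f => n / 8 + 2 * n * B.indicator (fun _ => (1 : ℝ)) f) (B := 2 * n)
      (B' := n / 8 + 2 * n)
      (fun f => by rw [abs_of_nonneg (hsum0 f)]; exact hsum2 f)
      (fun f => (abs_add_le _ _).trans (add_le_add (by rw [abs_of_pos (by positivity)]) (hind f)))
      (fun f => by
        by_cases hf : f ∈ B
        · simp only [hf, Set.indicator_of_mem]
          linarith [hsum2 f]
        · have h2 : massProb (uniformMass z) {p | f p.1 ≠ p.2} ≤ 1 / 16 := not_lt.mp hf
          rw [hloss, div_le_iff₀ (by positivity)] at h2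
          simp only [hf, not_false_eq_true, Set.indicator_of_notMem]
          linarith)
    rw [hpm.expect_sum _ fun j _ => her j,
      hpm.expect_add (f := fun _ => (n : ℝ) / 8) (B := n / 8)
        (fun _ => by rw [abs_of_pos (by positivity)]) hind,
      hpm.expect_const, IsProbMass.expect_const_mul, ← IsProbMass.massProb_eq_expect] at h1
    rw [Finset.sum_congr rfl fun j _ => hexp j] at h1
    nlinarith
  obtain ⟨j, hjn, hj1, hj2, hj⟩ : ∃ j < n, (∀ i, (I i : ℕ) ≠ j) ∧ (∀ i, (I i : ℕ) ≠ n + j) ∧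
      1 / 2 ≤ e (n + j) - e j := by
    by_contra! hcon
    let U : Finset ℕ := Finset.univ.image fun i => if (I i : ℕ) < n then (I i : ℕ) else I i - n
    have hU : U.card ≤ m := Finset.card_image_le.trans (by simp)
    have hlow : ∀ j ∈ Finset.range n \ U, 1 / 2 ≤ e j + (1 - e (n + j)) := fun j hj => by
      obtain ⟨hj, hjU⟩ := Finset.mem_sdiff.mp hj
      have hjn := Finset.mem_range.mp hj
      have := hcon j hjn
        (fun i hi => hjU (Finset.mem_image.mpr ⟨i, Finset.mem_univ _, by simp [hi, hjn]⟩))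
        (fun i hi => hjU (Finset.mem_image.mpr ⟨i, Finset.mem_univ _, by simp [hi]⟩))
      linarith
    have h1 : ((Finset.range n \ U).card : ℝ) * (1 / 2) ≤
        ∑ j ∈ Finset.range n, (e j + (1 - e (n + j))) := by
      rw [← nsmul_eq_mul]
      refine (Finset.card_nsmul_le_sum _ _ _ hlow).trans
        (Finset.sum_le_sum_of_subset_of_nonneg Finset.sdiff_subset fun j _ _ => ?_)
      linarith [he0 j, he1 (n + j)]
    have h2 : (n : ℝ) - m ≤ ((Finset.range n \ U).card : ℝ) := by
      have := Finset.le_card_sdiff U (Finset.range n)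
      rw [Finset.card_range] at this
      rw [sub_le_iff_le_add]
      exact_mod_cast (by omega : n ≤ (Finset.range n \ U).card + m)
    have h3 : (4 : ℝ) * m < n := by exact_mod_cast hn
    linarith
  exact ⟨fun i => I i, fun a b hab => hI (Fin.ext hab), fun i => (I i).2, j, n + j, by omega,
    by omega, hj1, hj2, hj⟩

theorem posInd_mul_self {X : Type*} (x : X) (f : X → Bool) :
    posInd x f * posInd x f = posInd x f := by
  unfold posInd
  split_ifs <;> norm_num

/-- A real sequence that grows by more than `1 / 4` within `m` steps has a step of `1 / (4 * m)`. -/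
theorem exists_large_step {F : ℕ → ℝ} {m r s : ℕ} (hm : 1 ≤ m) (hrs : r ≤ s) (hs : s ≤ m)
    (h : 1 / 4 < F s - F r) : ∃ k, k < s ∧ 1 / (4 * m) ≤ F (k + 1) - F k := by
  by_contra! hcon
  have hm' : (0 : ℝ) < m := by exact_mod_cast hm
  have key : ∀ k, r + k ≤ s → F (r + k) - F r ≤ k * (1 / (4 * m)) := by
    intro k
    induction k with
    | zero => simp
    | succ k ih =>
      intro hk
      have h1 := ih (by omega)
      have h2 := hcon (r + k) (by omega)
      rw [← add_assoc]
      push_cast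
      linarith
  have h1 := key (s - r) (by omega)
  rw [Nat.add_sub_cancel' hrs] at h1
  have h2 : ((s - r : ℕ) : ℝ) ≤ m := by exact_mod_cast (by omega : s - r ≤ m)
  have h3 : ((s - r : ℕ) : ℝ) * (1 / (4 * m)) ≤ m * (1 / (4 * m)) :=
    mul_le_mul_of_nonneg_right h2 (by positivity)
  have h4 : (m : ℝ) * (1 / (4 * m)) = 1 / 4 := by field_simp
  linarith

/-- The number of entries of `I` below `x`. -/
def rankIn {m : ℕ} (I : Fin m → ℕ) (x : ℕ) : ℕ := (Finset.univ.filter fun i => I i < x).card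

section rankIn

variable {m : ℕ} {I : Fin m → ℕ}

theorem rankIn_mono {x y : ℕ} (h : x ≤ y) : rankIn I x ≤ rankIn I y :=
  Finset.card_le_card fun i hi => by
    simp only [Finset.mem_filter, Finset.mem_univ, true_and] at hi ⊢
    omega

theorem rankIn_lt {i : Fin m} {y : ℕ} (h : I i < y) : rankIn I (I i) < rankIn I y := by
  refine Finset.card_lt_card ⟨fun j hj => ?_, fun hsub => ?_⟩
  · simp only [Finset.mem_filter, Finset.mem_univ, true_and] at hj ⊢
    omega
  · have := hsub (Finset.mem_filter.mpr ⟨Finset.mem_univ i, h⟩)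
    simp at this

theorem rankIn_le (x : ℕ) : rankIn I x ≤ m :=
  (Finset.card_le_univ _).trans (by simp)

theorem exists_rankIn_eq (hI : Function.Injective I) {r : ℕ} (hr : r < m) :
    ∃ i, rankIn I (I i) = r := by
  let ρ : Fin m → Fin m := fun i =>
    ⟨rankIn I (I i), (rankIn_lt (Nat.lt_succ_self (I i))).trans_le (rankIn_le _)⟩
  have hρ : Function.Injective ρ := by
    intro i j hij
    have h : rankIn I (I i) = rankIn I (I j) := congrArg Fin.val hij
    rcases lt_trichotomy (I i) (I j) with h1 | h1 | h1
    · have := rankIn_lt h1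
      omega
    · exact hI h1
    · have := rankIn_lt h1
      omega
  obtain ⟨i, hi⟩ := Finite.surjective_of_injective hρ ⟨r, hr⟩
  exact ⟨i, congrArg Fin.val hi⟩

theorem injective_of_lt_imp_lt {I' : Fin m → ℕ} (hI : Function.Injective I)
    (h : ∀ i j, I i < I j → I' i < I' j) : Function.Injective I' := by
  intro i j hij
  rcases lt_trichotomy (I i) (I j) with h1 | h1 | h1
  · have := h i j h1
    omega
  · exact hI h1
  · have := h j i h1
    omega

end rankIn

section pairExpect

variable {X : Type*} {m : ℕ} (A : (Fin m → X × Bool) → (X → Bool) → ℝ) (y : ℕ → X)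
  (b : Fin m → Bool)

/-- The probability that the hypothesis learnt from the points `y (I i)` with labels `b i` is
positive at both `y u` and `y v`. -/
noncomputable def pairExpect (I : Fin m → ℕ) (u v : ℕ) : ℝ :=
  expect (A fun i => (y (I i), b i)) (fun f => posInd (y u) f * posInd (y v) f)

theorem pairExpect_self (I : Fin m → ℕ) (u : ℕ) :
    pairExpect A y b I u u = expect (A fun i => (y (I i), b i)) (posInd (y u)) := by
  simp only [pairExpect, posInd_mul_self]

theorem pairExpect_comm (I : Fin m → ℕ) (u v : ℕ) :
    pairExpect A y b I u v = pairExpect A y b I v u := by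
  simp only [pairExpect, mul_comm]

variable {A}

theorem pairExpect_nonneg (hA : ∀ S, IsProbMass (A S)) (I : Fin m → ℕ) (u v : ℕ) :
    0 ≤ pairExpect A y b I u v :=
  (hA _).expect_nonneg fun _ => mul_nonneg (posInd_nonneg _ _) (posInd_nonneg _ _)

theorem pairExpect_le_one (hA : ∀ S, IsProbMass (A S)) (I : Fin m → ℕ) (u v : ℕ) :
    pairExpect A y b I u v ≤ 1 :=
  (hA _).expect_le_one (fun _ => mul_nonneg (posInd_nonneg _ _) (posInd_nonneg _ _))
    fun _ => mul_le_one₀ (posInd_le_one _ _) (posInd_nonneg _ _) (posInd_le_one _ _)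

end pairExpect

/-- `(I, u, v)` and `(I', u', v')` consist of distinct numbers in the same relative order. -/
structure SameOrder {m : ℕ} (I I' : Fin m → ℕ) (u v u' v' : ℕ) : Prop where
  inj : Function.Injective I
  ne_left : ∀ i, I i ≠ u
  ne_right : ∀ i, I i ≠ v
  left_lt_right : u < v
  left_lt_right' : u' < v'
  lt : ∀ i j, I i < I j → I' i < I' j
  lt_left : ∀ i, I i < u → I' i < u'
  left_lt : ∀ i, u < I i → u' < I' i
  lt_right : ∀ i, I i < v → I' i < v'
  right_lt : ∀ i, v < I i → v' < I' i

/-- Every learner is approximately invariant under order preserving changes of the sample and of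
the test points, on a long subsequence of the domain. -/
theorem exists_orderInvariant_points {X : Type*} {m : ℕ}
    {A : (Fin m → X × Bool) → (X → Bool) → ℝ} (hA : ∀ S, IsProbMass (A S)) (x : ℕ → X)
    (Q : ℕ) (hQ : 0 < Q) (M N : ℕ)
    (hN : ramseyBound ((Q + 1) ^ (2 ^ (m + 1) * (m + 2) ^ (m + 2))) M (m + 2) ≤ N) :
    ∃ g : ℕ → ℕ, (∀ i j, i < j → j < M → g i < g j) ∧ (∀ i < M, g i < N) ∧
      ∀ b I I' u v u' v', SameOrder I I' u v u' v' →
        (∀ i, I i < M) → (∀ i, I' i < M) → v < M → v' < M →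
        |pairExpect A (x ∘ g) b I u v - pairExpect A (x ∘ g) b I' u' v'| ≤ 1 / Q ∧
        |pairExpect A (x ∘ g) b I u u - pairExpect A (x ∘ g) b I' u' u'| ≤ 1 / Q := by
  let Γ : (Fin m → Bool) × Bool → (Fin m ⊕ Fin 2 → ℕ) → ℝ := fun k t =>
    pairExpect A x k.1 (t ∘ Sum.inl) (t (Sum.inr 0)) (t (Sum.inr (if k.2 then 1 else 0)))
  obtain ⟨g, hg, hgN, h⟩ := exists_orderInvariant_subsequence Γ
    (fun _ _ => pairExpect_nonneg _ _ hA _ _ _) (fun _ _ => pairExpect_le_one _ _ hA _ _ _)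
    Q hQ M N (by simpa [pow_succ] using hN)
  refine ⟨g, hg, hgN, fun b I I' u v u' v' ho hI hI' hv hv' => ?_⟩
  have huv := ho.left_lt_right
  have huv' := ho.left_lt_right'
  let t : Fin m ⊕ Fin 2 → ℕ := Sum.elim I ![u, v]
  let t' : Fin m ⊕ Fin 2 → ℕ := Sum.elim I' ![u', v']
  have ht : Function.Injective t := by
    refine ho.inj.sumElim ?_ ?_
    · intro i j hij
      fin_cases i <;> fin_cases j <;> simp at hij ⊢ <;> omega
    · intro i j
      fin_cases j
      · exact ho.ne_left i
      · exact ho.ne_right i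
  have htt' : ∀ i j, t i < t j → t' i < t' j := by
    rintro (i | i) (j | j) hij
    · exact ho.lt i j hij
    · fin_cases j
      · exact ho.lt_left i hij
      · exact ho.lt_right i hij
    · fin_cases i
      · exact ho.left_lt j hij
      · exact ho.right_lt j hij
    · fin_cases i <;> fin_cases j <;> simp [t, t'] at hij ⊢ <;> omega
  have htM : ∀ i, t i < M := by
    rintro (i | i)
    · exact hI i
    · fin_cases i
      · exact huv.trans hv
      · exact hv
  have htM' : ∀ i, t' i < M := by
    rintro (i | i)
    · exact hI' i
    · fin_cases i
      · exact huv'.trans hv'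
      · exact hv'
  exact ⟨h (b, true) t t' ht htt' htM htM', h (b, false) t t' ht htt' htM htM'⟩

/-- Privacy bounds the increase of the positivity probability across the sample point `i₀`, once
the learner is order invariant. -/
theorem PrivateAlg.step_sq_le {X : Type*} {m : ℕ} {ε δ η : ℝ}
    {A : (Fin m → X × Bool) → (X → Bool) → ℝ} (hA : ∀ S, IsProbMass (A S))
    (hpriv : PrivateAlg A ε δ) {y : ℕ → X} {b : Fin m → Bool} {M w : ℕ} (hw : 0 < w)
    (hMw : (w + 2) * (m + 1) < M - 1)
    (hinv : ∀ I I' u v u' v', SameOrder I I' u v u' v' →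
      (∀ i, I i < M) → (∀ i, I' i < M) → v < M → v' < M →
      |pairExpect A y b I u v - pairExpect A y b I' u' v'| ≤ 1 / w ∧
      |pairExpect A y b I u u - pairExpect A y b I' u' u'| ≤ 1 / w)
    {ρ : Fin m → ℕ} (hρ : Function.Injective ρ) (hρm : ∀ i, ρ i < m) (i₀ : Fin m) (hη : 0 ≤ η)
    (hstep : η + 2 / w ≤
      pairExpect A y b (fun i => (w + 2) * (ρ i + 1))
          ((w + 2) * (ρ i₀ + 1) + 1) ((w + 2) * (ρ i₀ + 1) + 1) -
        pairExpect A y b (fun i => (w + 2) * (ρ i + 1))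
          ((w + 2) * ρ i₀ + 1) ((w + 2) * ρ i₀ + 1)) :
    η ^ 2 ≤ Real.exp ε * (6 / w) + δ := by
  set I : Fin m → ℕ := fun i => (w + 2) * (ρ i + 1) with hI
  set R₀ := (w + 2) * ρ i₀ with hR₀
  obtain ⟨R₁, hR₁⟩ : ∃ R₁, R₁ = R₀ + (w + 2) := ⟨_, rfl⟩
  have hR₁' : (w + 2) * (ρ i₀ + 1) = R₁ := by rw [hR₁, hR₀]; ring
  rw [hR₁'] at hstep
  have hmul : ∀ {s t : ℕ}, s ≤ t → (w + 2) * s ≤ (w + 2) * t := fun h => Nat.mul_le_mul_left _ h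
  have hIm : ∀ i, I i < M - 1 := fun i => (hmul (by have := hρm i; omega)).trans_lt hMw
  have hRm : R₁ + (w + 2) < M := by
    have h1 : (w + 2) * (ρ i₀ + 2) ≤ (w + 2) * (m + 1) := hmul (by have := hρm i₀; omega)
    have h2 : (w + 2) * (ρ i₀ + 2) = R₁ + (w + 2) := by rw [← hR₁']; ring
    omega
  have hIcases : ∀ i, i ≠ i₀ → I i ≤ R₀ ∨ R₁ + (w + 2) ≤ I i := by
    intro i hi
    rcases lt_trichotomy (ρ i) (ρ i₀) with h | h | h
    · exact Or.inl (hmul h)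
    · exact absurd (hρ h) hi
    · right
      have h1 : (w + 2) * (ρ i₀ + 2) ≤ (w + 2) * (ρ i + 1) := hmul (by omega)
      have h2 : (w + 2) * (ρ i₀ + 2) = R₁ + (w + 2) := by rw [← hR₁']; ring
      simp only [hI]
      omega
  have hIi₀ : I i₀ = R₁ := hR₁'
  have hIcases' : ∀ i, I i ≤ R₀ ∨ I i = R₁ ∨ R₁ + (w + 2) ≤ I i := by
    intro i
    by_cases h : i = i₀
    · exact Or.inr (Or.inl (h ▸ hIi₀))
    · have := hIcases i h
      tauto
  have hIinj : Function.Injective I := by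
    intro i j hij
    have h : (w + 2) * (ρ i + 1) = (w + 2) * (ρ j + 1) := hij
    have := Nat.eq_of_mul_eq_mul_left (by omega) h
    exact hρ (by omega)
  set I' : Fin m → ℕ := Function.update I i₀ (R₁ + (w + 1)) with hI'
  have hI'i₀ : I' i₀ = R₁ + (w + 1) := Function.update_self ..
  have hI'ne : ∀ i, i ≠ i₀ → I' i = I i := fun i hi => Function.update_of_ne hi ..
  have hI'cases : ∀ i, I' i ≤ R₀ ∨ R₁ + (w + 1) ≤ I' i := by
    intro i
    by_cases h : i = i₀
    · exact Or.inr (h ▸ hI'i₀.ge)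
    · have := hIcases i h
      have := hI'ne i h
      omega
  have hI'M : ∀ i, I' i < M := by
    intro i
    by_cases h : i = i₀
    · subst h
      omega
    · have := hIm i
      have := hI'ne i h
      omega
  have hI'inj : Function.Injective I' := by
    intro i j hij
    by_cases hi : i = i₀ <;> by_cases hj : j = i₀
    · rw [hi, hj]
    · have := hIcases j hj
      have := hI'ne j hj
      subst hi
      omega
    · have := hIcases i hi
      have := hI'ne i hi
      subst hj
      omega
    · rw [hI'ne i hi, hI'ne j hj] at hij
      exact hIinj hij
  let pos : Fin w × Bool → ℕ := fun z => (if z.2 then R₁ else R₀) + 1 + z.1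
  have hpos : ∀ z, R₀ < pos z ∧ pos z < R₁ + (w + 1) := by
    rintro ⟨s, c⟩
    have := s.2
    cases c <;> simp only [pos] <;> simp <;> omega
  have hposinj : Function.Injective pos := by
    rintro ⟨s, c⟩ ⟨s', c'⟩ h
    have := s.2
    have := s'.2
    cases c <;> cases c' <;> simp [pos] at h ⊢ <;> omega
  have hclose : ∀ u u', (∀ i, I i < u ↔ I i < u') → (∀ i, u < I i ↔ u' < I i) →
      (∀ i, I i ≠ u) → u < M - 1 → u' < M - 1 →
      |pairExpect A y b I u u - pairExpect A y b I u' u'| ≤ 1 / w := by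
    intro u u' h1 h2 h3 h4 h5
    refine (hinv I I u (M - 1) u' (M - 1) ⟨hIinj, h3, fun i => (hIm i).ne, h4, h5, fun _ _ => id,
      fun i => (h1 i).1, fun i => (h2 i).1, fun _ => id, fun _ => id⟩ ?_ ?_ ?_ ?_).2
    · exact fun i => (hIm i).trans_le (Nat.sub_le _ _)
    · exact fun i => (hIm i).trans_le (Nat.sub_le _ _)
    · omega
    · omega
  have hprivI : Indist (A fun i => (y (I i), b i)) (A fun i => (y (I' i), b i)) ε δ :=
    hpriv _ _ ⟨i₀, fun i hi => by simp only [hI'ne i hi]⟩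
  have hexch : ∀ u v u' v', R₀ < u → u < v → v < R₁ + (w + 1) → R₀ < u' → u' < v' →
      v' < R₁ + (w + 1) →
      |pairExpect A y b I' u v - pairExpect A y b I' u' v'| ≤ 1 / w := by
    intro u v u' v' h1 h2 h3 h4 h5 h6
    refine (hinv I' I' u v u' v' ⟨hI'inj, ?_, ?_, h2, h5, fun _ _ => id, ?_, ?_, ?_, ?_⟩
      hI'M hI'M (by omega) (by omega)).1
    all_goals
      intro i
      have := hI'cases i
      omega
  have hbound := hprivI.block_separation_le (hA _) (hA _) (fun j => posInd (y j))
    (fun _ _ => posInd_nonneg _ _) (fun _ _ => posInd_le_one _ _) w hw pos hη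
    (c := pairExpect A y b I' (R₀ + 1) (R₀ + 2)) (κ := 1 / w) ?_ (pairExpect_nonneg _ _ hA _ _ _)
    ?_ (by positivity)
  · have : (2 : ℝ) / w + 4 * (1 / w) = 6 / w := by ring
    rwa [this] at hbound
  · intro s
    have hs := s.2
    have h1 := hclose (R₁ + 1) (pos (s, true))
    have h2 := hclose (R₀ + 1) (pos (s, false))
    simp only [pos, if_true, Bool.false_eq_true, if_false] at h1 h2 ⊢
    rw [← pairExpect_self, ← pairExpect_self]
    have h1 := abs_le.1 (h1 (fun i => by have := hIcases' i; omega)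
      (fun i => by have := hIcases' i; omega) (fun i => by have := hIcases' i; omega)
      (by omega) (by omega))
    have h2 := abs_le.1 (h2 (fun i => by have := hIcases' i; omega)
      (fun i => by have := hIcases' i; omega) (fun i => by have := hIcases' i; omega)
      (by omega) (by omega))
    have h3 : (2 : ℝ) / w = 1 / w + 1 / w := by ring
    linarith [h1.1, h1.2, h2.1, h2.2]
  · intro z z' hz
    have h1 := hpos z
    have h2 := hpos z'
    rcases lt_or_gt_of_ne (hposinj.ne hz) with h | h
    · exact hexch _ _ _ _ h1.1 h h2.2 (by omega) (by omega) (by omega)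
    · change |pairExpect A y b I' (pos z) (pos z') - _| ≤ _
      rw [pairExpect_comm]
      exact hexch _ _ _ _ h2.1 h h1.2 (by omega) (by omega) (by omega)

/-- A private accurate learner on `m` examples contradicts order invariance on many points. -/
theorem ContainsThresholds.lt_of_private_accurate {X : Type*} {H : Set (X → Bool)} {d m : ℕ}
    {δ : ℝ} {A : (Fin m → X × Bool) → (X → Bool) → ℝ} (hm : 1 ≤ m)
    (hδ : δ ≤ 1 / 1000 / (m : ℝ) ^ 2) (hA : ∀ S, IsProbMass (A S)) (hpriv : PrivateAlg A 0.1 δ)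
    (hacc : AccurateLearner H A (1 / 16) (1 / 16)) (hH : ContainsThresholds H d) :
    d < ramseyBound ((1000 * m ^ 2 + 1) ^ (2 ^ (m + 1) * (m + 2) ^ (m + 2)))
      (3000 * m ^ 3) (m + 2) := by
  by_contra! hd
  have hd0 : 0 < d := by
    refine lt_of_lt_of_le ?_ hd
    rw [ramseyBound]
    positivity
  obtain ⟨x₀, h₀, hh₀, hx₀⟩ := hH
  have hm1 : m ≤ m ^ 2 := by nlinarith
  have hm2 : m ^ 2 ≤ m ^ 3 := Nat.pow_le_pow_right hm (by norm_num)
  have hm0 : (0 : ℝ) < m := by exact_mod_cast hm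
  have hm1' : (1 : ℝ) ≤ m := by exact_mod_cast hm
  set M := 3000 * m ^ 3 with hM
  set w := 1000 * m ^ 2 with hw
  have hw0 : 0 < w := by omega
  have hwR : (w : ℝ) = 1000 * (m : ℝ) ^ 2 := by rw [hw]; push_cast; ring
  have hMW : (w + 2) * (m + 1) < M - 1 := by
    have : (w + 2) * (m + 1) = 1000 * m ^ 3 + 1000 * m ^ 2 + 2 * m + 2 := by
      rw [hw]
      ring
    omega
  let x : ℕ → X := fun j => if h : j < d then x₀ ⟨j, h⟩ else x₀ ⟨0, hd0⟩
  obtain ⟨g, hg, hgN, hinv⟩ := exists_orderInvariant_points hA x w hw0 M d hd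
  have hy : ∀ i (hi : i < M), (x ∘ g) i = x₀ ⟨g i, hgN i hi⟩ := fun i hi => dif_pos (hgN i hi)
  have hgle : ∀ i j, i < M → j < M → (g i ≤ g j ↔ i ≤ j) := by
    intro i j hi hj
    rcases lt_trichotomy i j with h | rfl | h
    · have := hg i j h hj
      omega
    · simp
    · have := hg j i h hi
      omega
  set n := 8 * m ^ 2 with hn
  have hnM : 2 * n < M - 1 := by omega
  obtain ⟨I, hI, hIn, lo, hi, hlohi, hhi, hIlo, hIhi, hsep⟩ :=
    hacc.exists_separated_points hA (x ∘ g) n (by nlinarith) (by omega)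
      (by
        intro i hi j hj hij
        have h1 := hx₀ ⟨g i, hgN i (by omega)⟩ ⟨g j, hgN j (by omega)⟩
        have h2 := hx₀ ⟨g j, hgN j (by omega)⟩ ⟨g i, hgN i (by omega)⟩
        have h3 := hx₀ ⟨g i, hgN i (by omega)⟩ ⟨g i, hgN i (by omega)⟩
        have h4 := hx₀ ⟨g j, hgN j (by omega)⟩ ⟨g j, hgN j (by omega)⟩
        rw [hy i (by omega), hy j (by omega)] at hij
        rw [← hij] at h1 h4
        rw [hij] at h2
        rw [← hij] at h2
        have h5 : g i ≤ g j := h1.1 (h3.2 le_rfl)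
        have h6 : g j ≤ g i := h2.1 (h4.2 le_rfl)
        rw [hgle _ _ (by omega) (by omega)] at h5 h6
        omega)
      (hh₀ ⟨g n, hgN n (by omega)⟩)
      (by
        intro j hj
        rw [hy j (by omega), Bool.eq_iff_iff, hx₀, decide_eq_true_iff]
        exact hgle n j (by omega) (by omega))
  set b : Fin m → Bool := fun i => decide (n ≤ I i) with hb
  rw [← pairExpect_self A (x ∘ g) b I, ← pairExpect_self A (x ∘ g) b I] at hsep
  let I₁ : Fin m → ℕ := fun i => (w + 2) * (rankIn I (I i) + 1)
  have hρm : ∀ i, rankIn I (I i) < m := fun i =>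
    (rankIn_lt (Nat.lt_succ_self (I i))).trans_le (rankIn_le _)
  have hρ : Function.Injective fun i => rankIn I (I i) :=
    injective_of_lt_imp_lt hI fun i j h => rankIn_lt h
  have hI₁M : ∀ i, I₁ i < M - 1 := fun i =>
    (Nat.mul_le_mul_left _ (by have := hρm i; omega)).trans_lt hMW
  let F : ℕ → ℝ := fun r => pairExpect A (x ∘ g) b I₁ ((w + 2) * r + 1) ((w + 2) * r + 1)
  have hF : ∀ u < 2 * n, (∀ i, I i ≠ u) →
      |pairExpect A (x ∘ g) b I u u - F (rankIn I u)| ≤ 1 / w := by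
    intro u hu hIu
    have hum : (w + 2) * rankIn I u + 1 < M - 1 := by
      have h1 : (w + 2) * rankIn I u ≤ (w + 2) * m := Nat.mul_le_mul_left _ (rankIn_le _)
      have h2 : (w + 2) * (m + 1) = (w + 2) * m + (w + 2) := by ring
      omega
    have hleft : ∀ i, I i < u → I₁ i < (w + 2) * rankIn I u + 1 := fun i h =>
      Nat.lt_succ_of_le (Nat.mul_le_mul_left _ (rankIn_lt h))
    have hright : ∀ i, u < I i → (w + 2) * rankIn I u + 1 < I₁ i := by
      intro i h
      have h1 : (w + 2) * rankIn I u ≤ (w + 2) * rankIn I (I i) :=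
        Nat.mul_le_mul_left _ (rankIn_mono h.le)
      have h2 : I₁ i = (w + 2) * rankIn I (I i) + (w + 2) := by simp only [I₁]; ring
      omega
    refine (hinv b I I₁ u (M - 1) ((w + 2) * rankIn I u + 1) (M - 1)
      ⟨hI, hIu, fun i => ?_, by omega, hum, fun i j h => ?_, hleft, hright, fun i _ => hI₁M i,
        fun i h => ?_⟩ ?_ ?_ (by omega) (by omega)).2
    · have := hIn i
      omega
    · have := rankIn_lt h
      exact Nat.mul_lt_mul_of_pos_left (by omega) (by omega)
    · have := hIn i
      omega
    · intro i
      have := hIn i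
      omega
    · intro i
      have := hI₁M i
      omega
  have hw1 : 1 / (w : ℝ) ≤ 1 / 1000 := by
    rw [hwR]
    apply one_div_le_one_div_of_le (by norm_num)
    nlinarith
  have hlo := abs_le.1 (hF lo (by omega) hIlo)
  have hhi' := abs_le.1 (hF hi hhi hIhi)
  obtain ⟨r, hr, hstep⟩ := exists_large_step (F := F) hm (rankIn_mono (I := I) hlohi.le)
    (rankIn_le _) (by linarith [hlo.1, hlo.2, hhi'.1, hhi'.2])
  obtain ⟨i₀, hi₀⟩ := exists_rankIn_eq hI (hr.trans_le (rankIn_le _))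
  have hfinal := hpriv.step_sq_le (η := 1 / (8 * m)) hA hw0 hMW (hinv b) hρ hρm i₀
    (by positivity) (by
      simp only [hi₀]
      refine le_trans ?_ hstep
      rw [hwR]
      have h1 : (1 : ℝ) / (4 * m) = 1 / (8 * m) + 1 / (8 * m) := by field_simp; norm_num
      rw [h1]
      refine add_le_add le_rfl ?_
      rw [div_le_div_iff₀ (by positivity) (by positivity)]
      nlinarith)
  have hexp : Real.exp 0.1 ≤ 10 / 9 := by
    have h1 := Real.add_one_le_exp (-0.1)
    have h2 : Real.exp 0.1 * Real.exp (-0.1) = 1 := by rw [← Real.exp_add]; norm_num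
    nlinarith [Real.exp_pos 0.1]
  have h1 : Real.exp 0.1 * (6 / w) ≤ 10 / 9 * (6 / w) := by gcongr
  have h2 : (1 / (8 * (m : ℝ))) ^ 2 = 1 / 64 * (1 / (m : ℝ) ^ 2) := by field_simp; norm_num
  have h3 : (10 / 9 * (6 / w) : ℝ) = 1 / 150 * (1 / (m : ℝ) ^ 2) := by
    rw [hwR]; field_simp; norm_num
  have h4 : (1 / 1000 / (m : ℝ) ^ 2) = 1 / 1000 * (1 / (m : ℝ) ^ 2) := by field_simp
  have h5 : 0 < 1 / (m : ℝ) ^ 2 := by positivity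
  rw [h2] at hfinal
  rw [h4] at hδ
  linarith

theorem ContainsThresholds.lt_tower {X : Type*} {H : Set (X → Bool)} {d m : ℕ}
    {δ : ℝ} {A : (Fin m → X × Bool) → (X → Bool) → ℝ} (hm : 1 ≤ m)
    (hδ : δ ≤ 1 / 1000 / (m : ℝ) ^ 2) (hA : ∀ S, IsProbMass (A S)) (hpriv : PrivateAlg A 0.1 δ)
    (hacc : AccurateLearner H A (1 / 16) (1 / 16)) (hH : ContainsThresholds H d) :
    d < tower (4 * m + 12) 1 :=
  (hH.lt_of_private_accurate hm hδ hA hpriv hacc).trans_le (ramseyBound_sample_le_tower m)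

theorem LdimGe.lt_tower {X : Type*} {H : Set (X → Bool)} {d m : ℕ}
    {δ : ℝ} {A : (Fin m → X × Bool) → (X → Bool) → ℝ} (hm : 1 ≤ m)
    (hδ : δ ≤ 1 / 1000 / (m : ℝ) ^ 2) (hA : ∀ S, IsProbMass (A S)) (hpriv : PrivateAlg A 0.1 δ)
    (hacc : AccurateLearner H A (1 / 16) (1 / 16)) (hH : LdimGe H d) :
    d < tower (4 * m + 14) 1 := by
  set N := tower (4 * m + 12) 1 with hN
  have hd : d < 4 ^ (2 * N + 1) := by
    by_contra! hd
    exact ((hH.containsThresholds hd).lt_tower hm hδ hA hpriv hacc).false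
  have hN5 : 5 ≤ N := (by omega : 5 ≤ 1 + (4 * m + 12)).trans (add_le_tower _ _)
  have hpow : 4 * N + 2 ≤ 2 ^ N := by
    clear_value N
    clear hd hN
    induction N, hN5 using Nat.le_induction with
    | base => norm_num
    | succ n _ ih =>
      rw [pow_succ]
      omega
  calc d < 4 ^ (2 * N + 1) := hd
    _ = 2 ^ (4 * N + 2) := by
      rw [show (4 : ℕ) = 2 ^ 2 by norm_num, ← pow_mul]
      ring_nf
    _ ≤ 2 ^ 2 ^ N := Nat.pow_le_pow_right (by norm_num) hpow
    _ = tower (4 * m + 14) 1 := by rw [tower_succ, tower_succ]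

/-- Any `(1/16,1/16)`-accurate, `(0.1, O(1/(m² log m)))`-differentially private
learner for a class containing `d` thresholds (in particular, for a class of
Littlestone dimension `d`) requires `m ≥ Ω(log* d)` samples. -/
theorem private_learning_lower_bound :
    ∃ c₀ a C : ℝ, 0 < c₀ ∧ 0 < a ∧
      ∀ (X : Type) (H : Set (X → Bool)) (d m : ℕ) (δ : ℝ)
        (A : (Fin m → X × Bool) → (X → Bool) → ℝ),
        1 ≤ m → 0 ≤ δ → δ ≤ c₀ / ((m : ℝ) ^ 2 * Real.logb 2 m) →
        (∀ S, IsProbMass (A S)) →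
        PrivateAlg A 0.1 δ →
        AccurateLearner H A (1 / 16) (1 / 16) →
        (ContainsThresholds H d ∨ LdimGe H d) →
        a * (logStar (d : ℝ) : ℝ) - C ≤ (m : ℝ) := by
  refine ⟨1 / 1000, 1 / 4, 4, by norm_num, by norm_num, ?_⟩
  intro X H d m δ A hm hδ0 hδ hA hpriv hacc hH
  have hδ' : δ ≤ 1 / 1000 / (m : ℝ) ^ 2 := by
    refine hδ.trans ?_
    rcases hm.eq_or_lt with rfl | hm2
    · norm_num
    · have hlog : 1 ≤ Real.logb 2 m := by
        rw [Real.le_logb_iff_rpow_le (by norm_num) (by positivity)]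
        simpa using (by exact_mod_cast hm2 : (2 : ℝ) ≤ m)
      have hm0 : (0 : ℝ) < (m : ℝ) ^ 2 := by positivity
      exact div_le_div_of_nonneg_left (by norm_num) hm0 (le_mul_of_one_le_right hm0.le hlog)
  have hd : d ≤ tower (4 * m + 14) 1 := by
    rcases hH with hH | hH
    · refine (hH.lt_tower hm hδ' hA hpriv hacc).le.trans ?_
      rw [tower_succ (4 * m + 13), tower_succ (4 * m + 12)]
      exact Nat.lt_two_pow_self.le.trans Nat.lt_two_pow_self.le
    · exact (hH.lt_tower hm hδ' hA hpriv hacc).le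
  have hstar : (logStar (d : ℝ) : ℝ) ≤ 4 * m + 14 := by
    exact_mod_cast logStar_le_of_le_tower hd
  linarith
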